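/- arXiv:1301.1613 — 4 statements merged into one kernel-verified Lean document; each statement's English description precedes it below -/
import Mathlib

section
/- Let d ≥ 2 and let u : ℝ^d → ℝ be twice continuously differentiable with ∇u(x₀) ≠ 0 at a given point x₀ ∈ ℝ^d. Then there exist an open neighborhood V of x₀ and a continuous function σ : V → ℝ with σ(x) > 0 for all x ∈ V such that σ∇u is divergence free in V in the sense of distributions, i.e. ∫_V σ(x) (∇u(x) · ∇φ(x)) dx = 0 for every smooth function φ with compact support in V. (Local isotropic realizability, Theorem 2.1(i).) -/
open MeasureTheory
open scoped RealInnerProductSpace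
open Set Filter
open scoped Topology

section Nemytskii

variable {K E G : Type*} [TopologicalSpace K] [CompactSpace K]
  [NormedAddCommGroup E] [NormedSpace ℝ E] [NormedAddCommGroup G] [NormedSpace ℝ G]

/-- Pointwise application of a continuous family of continuous linear maps to a continuous map,
as a continuous linear map between spaces of continuous maps. -/
noncomputable def ContinuousMap.pointwiseCLM :
    C(K, E →L[ℝ] G) →L[ℝ] C(K, E) →L[ℝ] C(K, G) :=
  LinearMap.mkContinuous₂
    (LinearMap.mk₂ ℝ (fun (A : C(K, E →L[ℝ] G)) (h : C(K, E)) =>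
        (⟨fun t => A t (h t), by fun_prop⟩ : C(K, G)))
      (fun A B h => by ext; simp) (fun c A h => by ext; simp)
      (fun A h k => by ext; simp) (fun c A h => by ext; simp))
    1 (fun A h => by
      rw [ContinuousMap.norm_le _ (by positivity)]
      intro t
      simp only [LinearMap.mk₂_apply, ContinuousMap.coe_mk, one_mul]
      exact (A t).le_of_opNorm_le_of_le (A.norm_coe_le_norm t) (h.norm_coe_le_norm t))

@[simp]
theorem ContinuousMap.pointwiseCLM_apply (A : C(K, E →L[ℝ] G)) (h : C(K, E)) (t : K) :
    ContinuousMap.pointwiseCLM A h t = A t (h t) := rfl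

/-- Postcomposition with a `C¹` map is differentiable on the space of continuous maps. -/
theorem ContDiff.hasFDerivAt_comp_continuousMap {F : E → G} (hF : ContDiff ℝ 1 F) (γ : C(K, E)) :
    HasFDerivAt (fun γ : C(K, E) => (⟨F, hF.continuous⟩ : C(E, G)).comp γ)
      (ContinuousMap.pointwiseCLM
        ((⟨fderiv ℝ F, hF.continuous_fderiv one_ne_zero⟩ : C(E, E →L[ℝ] G)).comp γ)) γ := by
  rw [hasFDerivAt_iff_isLittleO_nhds_zero, Asymptotics.isLittleO_iff]
  intro c hc
  let D : C(K, E) → C(K, E →L[ℝ] G) :=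
    (⟨fderiv ℝ F, hF.continuous_fderiv one_ne_zero⟩ : C(E, E →L[ℝ] G)).comp
  have hD : Tendsto D (𝓝 γ) (𝓝 (D γ)) := (ContinuousMap.continuous_postcomp _).tendsto γ
  obtain ⟨δ, hδ, hδc⟩ := Metric.eventually_nhds_iff.1 (hD (Metric.ball_mem_nhds (D γ) hc))
  filter_upwards [Metric.ball_mem_nhds (0 : C(K, E)) hδ] with h hh
  rw [mem_ball_zero_iff] at hh
  rw [ContinuousMap.norm_le _ (by positivity)]
  intro t
  have key : ∀ z ∈ Metric.ball (γ t) δ, ‖fderiv ℝ F z - fderiv ℝ F (γ t)‖ ≤ c := by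
    intro z hz
    have h1 : Dist.dist (γ + ContinuousMap.const K (z - γ t)) γ < δ := by
      rw [dist_eq_norm, add_sub_cancel_left]
      refine lt_of_le_of_lt ?_ (mem_ball_iff_norm.1 hz)
      rw [ContinuousMap.norm_le _ (norm_nonneg _)]
      intro; simp
    have h2 := (ContinuousMap.dist_apply_le_dist t).trans (Metric.mem_ball.1 (hδc h1)).le
    simpa [D, dist_eq_norm] using h2
  have hmem : γ t + h t ∈ Metric.ball (γ t) δ := by
    rw [mem_ball_iff_norm, add_sub_cancel_left]
    exact (h.norm_coe_le_norm t).trans_lt hh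
  have := (convex_ball (γ t) δ).norm_image_sub_le_of_norm_hasFDerivWithin_le'
    (f := F) (f' := fderiv ℝ F) (φ := fderiv ℝ F (γ t)) (C := c)
    (fun z _ => ((hF.differentiable one_ne_zero) z).hasFDerivAt.hasFDerivWithinAt) key
    (Metric.mem_ball_self hδ) hmem
  rw [add_sub_cancel_left] at this
  simp only [ContinuousMap.sub_apply, ContinuousMap.comp_apply, ContinuousMap.coe_mk,
    ContinuousMap.add_apply, ContinuousMap.pointwiseCLM_apply]
  exact this.trans (by gcongr; exact h.norm_coe_le_norm t)

/-- Postcomposition with a `C¹` map is `C¹` on the space of continuous maps. -/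
theorem ContDiff.contDiff_comp_continuousMap {F : E → G} (hF : ContDiff ℝ 1 F) :
    ContDiff ℝ 1 (fun γ : C(K, E) => (⟨F, hF.continuous⟩ : C(E, G)).comp γ) :=
  contDiff_one_iff_hasFDerivAt.2 ⟨_,
    ContinuousMap.pointwiseCLM.continuous.comp (ContinuousMap.continuous_postcomp _),
    hF.hasFDerivAt_comp_continuousMap⟩

end Nemytskii

section Flow

variable {E : Type*} [NormedAddCommGroup E] [NormedSpace ℝ E]

/-- Integration from `0`, as a continuous linear map on continuous maps on `[-1, 1]`. -/
noncomputable def integralFromZeroCLM : C(Icc (-1 : ℝ) 1, E) →L[ℝ] C(Icc (-1 : ℝ) 1, E) :=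
  LinearMap.mkContinuous
    { toFun := fun g =>
        ⟨fun t => ∫ s in (0 : ℝ)..t, g (projIcc (-1) 1 (neg_le_self zero_le_one) s),
          (intervalIntegral.continuous_primitive
            (fun a b => (g.continuous.comp continuous_projIcc).intervalIntegrable a b) 0).comp
            continuous_subtype_val⟩
      map_add' := fun g h => by
        ext t
        exact intervalIntegral.integral_add
          ((g.continuous.comp continuous_projIcc).intervalIntegrable _ _)
          ((h.continuous.comp continuous_projIcc).intervalIntegrable _ _)
      map_smul' := fun c g => by
        ext t
        exact intervalIntegral.integral_smul _ _ }
    1 (fun g => by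
      rw [ContinuousMap.norm_le _ (by positivity)]
      intro t
      refine (intervalIntegral.norm_integral_le_of_norm_le_const
        (C := ‖g‖) (fun s _ => g.norm_coe_le_norm _)).trans ?_
      rw [mul_comm, sub_zero]
      gcongr
      exact abs_le.2 t.2)

theorem integralFromZeroCLM_apply (g : C(Icc (-1 : ℝ) 1, E)) (t : Icc (-1 : ℝ) 1) :
    integralFromZeroCLM g t = ∫ s in (0 : ℝ)..t, g (projIcc (-1) 1 (neg_le_self zero_le_one) s) :=
  rfl

/-- Integral curves of a `C¹` vector field, up to a rescaling of time, on a fixed time interval,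
with `C¹` dependence on the initial condition. -/
theorem ContDiff.exists_contDiffAt_integralCurve [CompleteSpace E] {F : E → E}
    (hF : ContDiff ℝ 1 F) (x₀ : E) :
    ∃ ε : ℝ, ε ≠ 0 ∧ ∃ γ : E → C(Icc (-1 : ℝ) 1, E), ∀ᶠ x in 𝓝 x₀, ContDiffAt ℝ 1 γ x ∧
      γ x = ContinuousMap.const _ x +
        ε • integralFromZeroCLM ((⟨F, hF.continuous⟩ : C(E, E)).comp (γ x)) := by
  let constL : E →L[ℝ] C(Icc (-1 : ℝ) 1, E) := ContinuousLinearMap.const ℝ _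
  let f : (ℝ × E) × C(Icc (-1 : ℝ) 1, E) → C(Icc (-1 : ℝ) 1, E) := fun p =>
    p.2 - constL p.1.2 -
      p.1.1 • integralFromZeroCLM ((⟨F, hF.continuous⟩ : C(E, E)).comp p.2)
  let u : (ℝ × E) × C(Icc (-1 : ℝ) 1, E) := ((0, x₀), constL x₀)
  have hf : ContDiff ℝ 1 f := by
    refine (contDiff_snd.sub (constL.contDiff.comp (contDiff_snd.comp contDiff_fst))).sub ?_
    exact (contDiff_fst.comp contDiff_fst).smul
      (integralFromZeroCLM.contDiff.comp (hF.contDiff_comp_continuousMap.comp contDiff_snd))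
  have hfu : f u = 0 := by simp [f, u]
  have hinr : fderiv ℝ f u ∘L .inr ℝ (ℝ × E) C(Icc (-1 : ℝ) 1, E) = .id ℝ _ := by
    have h1 : HasFDerivAt (fun g : C(Icc (-1 : ℝ) 1, E) => f ((0, x₀), g))
        (fderiv ℝ f u ∘L .inr ℝ (ℝ × E) C(Icc (-1 : ℝ) 1, E)) (constL x₀) :=
      HasFDerivAt.comp (constL x₀) ((hf.differentiable one_ne_zero) u).hasFDerivAt
        (hasFDerivAt_prodMk_right (0, x₀) (constL x₀))
    have h2 : HasFDerivAt (fun g : C(Icc (-1 : ℝ) 1, E) => f ((0, x₀), g)) (.id ℝ _)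
        (constL x₀) := by
      simpa [f] using (hasFDerivAt_id (constL x₀)).sub_const (constL x₀)
    exact h1.unique h2
  have hinv : (fderiv ℝ f u ∘L .inr ℝ (ℝ × E) C(Icc (-1 : ℝ) 1, E)).IsInvertible := by
    rw [hinr]
    exact ⟨.refl ℝ _, rfl⟩
  have hfat : ContDiffAt ℝ 1 f u := hf.contDiffAt
  have hev := ((hfat.contDiffAt_implicitFunction one_ne_zero hinv).eventually (by simp)).and
    (hfat.eventually_apply_implicitFunction one_ne_zero hinv)
  have hev' : ∀ᶠ ε in 𝓝[≠] (0 : ℝ), _ := nhdsWithin_le_nhds hev.curry_nhds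
  obtain ⟨ε, hε, hε0⟩ := (hev'.and self_mem_nhdsWithin).exists
  refine ⟨ε, hε0, fun x => hfat.implicitFunction one_ne_zero hinv (ε, x), ?_⟩
  filter_upwards [hε] with x hx
  refine ⟨hx.1.comp x (contDiff_prodMk_right ε).contDiffAt, ?_⟩
  have h := hx.2
  rw [hfu] at h
  exact sub_eq_zero.1 ((sub_sub _ _ _).symm.trans h)

end Flow

section FlowBox

variable {E : Type*} [NormedAddCommGroup E] [InnerProductSpace ℝ E] [FiniteDimensional ℝ E]

/-- **Flow box theorem**: near a point where it does not vanish, a `C¹` vector field is the image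
of a constant vector field under a `C¹` map tangent to the identity at this point. -/
theorem ContDiff.exists_flowBox {F : E → E} (hF : ContDiff ℝ 1 F) {x₀ : E} (hx₀ : F x₀ ≠ 0) :
    ∃ (T : E → E) (T' : E → E →L[ℝ] E), T x₀ = x₀ ∧ T' x₀ = .id ℝ E ∧
      ∀ᶠ z in 𝓝 x₀, HasStrictFDerivAt T (T' z) z ∧ ContinuousAt T' z ∧
        T' z (F x₀) = F (T z) := by
  have : CompleteSpace E := FiniteDimensional.complete ℝ E
  obtain ⟨ε, hε, γ, hγ⟩ := hF.exists_contDiffAt_integralCurve x₀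
  set v := F x₀
  have hv2 : ‖v‖ ^ 2 ≠ 0 := by simpa using hx₀
  let π : ℝ → Icc (-1 : ℝ) 1 := projIcc (-1) 1 (neg_le_self zero_le_one)
  have hπ : Continuous π := continuous_projIcc
  let Φ : E → ℝ → E := fun y s => γ y (π s)
  let Φ₁ : E → ℝ → E →L[ℝ] E := fun y s => ContinuousMap.evalCLM ℝ (π s) ∘L fderiv ℝ γ y
  let Φ₂ : E → ℝ → ℝ →L[ℝ] E := fun y s => .toSpanSingleton ℝ (ε • F (γ y (π s)))
  have hγ_apply {y : E} (hy : γ y = ContinuousMap.const _ y +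
      ε • integralFromZeroCLM ((⟨F, hF.continuous⟩ : C(E, E)).comp (γ y))) {s : ℝ}
      (hs : s ∈ Icc (-1 : ℝ) 1) :
      Φ y s = y + ε • ∫ τ in (0 : ℝ)..s, F (γ y (π τ)) := by
    simpa [integralFromZeroCLM_apply, Φ, π, projIcc_of_mem _ hs] using DFunLike.congr_fun hy (π s)
  have hd₁ {y : E} (hy : ContDiffAt ℝ 1 γ y) (s : ℝ) : HasFDerivAt (Φ · s) (Φ₁ y s) y :=
    HasFDerivAt.comp (g := fun g : C(Icc (-1 : ℝ) 1, E) => g (π s)) y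
      (ContinuousMap.evalCLM ℝ (π s) : C(Icc (-1 : ℝ) 1, E) →L[ℝ] E).hasFDerivAt
      (hy.differentiableAt one_ne_zero).hasFDerivAt
  have hd₂ {y : E} (hy : γ y = ContinuousMap.const _ y +
      ε • integralFromZeroCLM ((⟨F, hF.continuous⟩ : C(E, E)).comp (γ y))) {s : ℝ}
      (hs : s ∈ Ioo (-1 : ℝ) 1) : HasFDerivAt (Φ y ·) (Φ₂ y s) s := by
    have hc : Continuous fun τ => F (γ y (π τ)) :=
      hF.continuous.comp ((γ y).continuous.comp hπ)
    have h := ((hc.integral_hasStrictDerivAt 0 s).hasDerivAt.const_smul ε).const_add y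
    refine (h.congr_of_eventuallyEq ?_).hasFDerivAt
    filter_upwards [Ioo_mem_nhds hs.1 hs.2] with r hr
    exact hγ_apply hy (Ioo_subset_Icc_self hr)
  have hc₁ {p : E × ℝ} (hy : ContDiffAt ℝ 1 γ p.1) : ContinuousAt ↿Φ₁ p := by
    rw [continuousAt_clm_apply]
    intro w
    have h : ContinuousAt (fderiv ℝ γ) p.1 :=
      (hy.fderiv_right (m := 0) (by simp)).continuousAt
    have h' : ContinuousAt (fun q : E × ℝ => fderiv ℝ γ q.1 w) p :=
      (h.comp (f := Prod.fst) continuousAt_fst).clm_apply continuousAt_const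
    exact h'.eval (hπ.continuousAt.comp continuousAt_snd)
  have hcΦ {p : E × ℝ} (hy : ContDiffAt ℝ 1 γ p.1) : ContinuousAt ↿Φ p :=
    (hy.continuousAt.comp continuousAt_fst).eval (hπ.continuousAt.comp continuousAt_snd)
  have hc₂ {p : E × ℝ} (hy : ContDiffAt ℝ 1 γ p.1) : ContinuousAt ↿Φ₂ p :=
    (ContinuousLinearMap.toSpanSingletonCLE (𝕜 := ℝ) (E := E)).continuous.continuousAt.comp
      ((hF.continuous.continuousAt.comp (hcΦ hy)).const_smul ε)
  let s' : E →L[ℝ] ℝ := (ε * ‖v‖ ^ 2)⁻¹ • innerSL ℝ v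
  let y' : E →L[ℝ] E := .id ℝ E - ε • s'.smulRight v
  have hs'v : s' v = ε⁻¹ := by
    simp only [s', smul_apply, innerSL_apply_apply, smul_eq_mul,
      real_inner_self_eq_norm_sq]
    field_simp
  have hy'v : y' v = 0 := by simp [y', hs'v, hε]
  let A : E → E × ℝ := fun z => (x₀, 0) + (y'.prod s') (z - x₀)
  have hA (z : E) : HasStrictFDerivAt A (y'.prod s') z := by
    have := ((y'.prod s').hasStrictFDerivAt (x := z - x₀)).comp z
      ((hasStrictFDerivAt_id z).sub_const x₀)
    exact this.const_add _
  have hAx₀ : A x₀ = (x₀, 0) := by simp [A]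
  have hAc : Continuous A := by fun_prop
  have hΦ0 : ∀ᶠ y in 𝓝 x₀, Φ y 0 = y := by
    filter_upwards [hγ] with y hy
    simpa using hγ_apply hy.2 (s := 0) (by simp)
  have hΦ₁0 : Φ₁ x₀ 0 = .id ℝ E :=
    (hd₁ hγ.self_of_nhds.1 0).unique ((hasFDerivAt_id x₀).congr_of_eventuallyEq hΦ0)
  refine ⟨fun z => ↿Φ (A z), fun z => ((↿Φ₁ (A z)).coprod (↿Φ₂ (A z))) ∘L (y'.prod s'),
    ?_, ?_, ?_⟩
  · simp only [hAx₀]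
    exact hΦ0.self_of_nhds
  · ext h
    have hF0 : F (γ x₀ (π 0)) = v := congrArg F hΦ0.self_of_nhds
    simp only [hAx₀]
    change Φ₁ x₀ 0 (y' h) + s' h • ε • F (γ x₀ (π 0)) = h
    rw [hΦ₁0, hF0]
    simp [y', smul_smul, mul_comm]
  · have hgood : ∀ᶠ p : E × ℝ in 𝓝 (x₀, 0),
        (ContDiffAt ℝ 1 γ p.1 ∧ γ p.1 = ContinuousMap.const _ p.1 +
          ε • integralFromZeroCLM ((⟨F, hF.continuous⟩ : C(E, E)).comp (γ p.1))) ∧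
        p.2 ∈ Ioo (-1 : ℝ) 1 :=
      ((continuousAt_fst (p := (x₀, (0 : ℝ)))).eventually hγ).and
        ((continuousAt_snd (p := (x₀, (0 : ℝ)))).eventually
          (Ioo_mem_nhds neg_one_lt_zero zero_lt_one))
    have hgoodA : ∀ᶠ z in 𝓝 x₀, ∀ᶠ p in 𝓝 (A z), _ :=
      hAc.continuousAt.eventually (hAx₀ ▸ hgood.eventually_nhds)
    filter_upwards [hgoodA] with z hz
    have hself := hz.self_of_nhds
    refine ⟨?_, ?_, ?_⟩
    · exact (hasStrictFDerivAt_uncurry_coprod (hz.mono fun p hp => hd₁ hp.1.1 p.2)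
        (hz.mono fun p hp => hd₂ hp.1.2 hp.2) (hc₁ hself.1.1) (hc₂ hself.1.1)).comp z (hA z)
    · have h1 := (hc₁ hself.1.1).comp hAc.continuousAt
      have h2 := (hc₂ hself.1.1).comp hAc.continuousAt
      exact (((ContinuousLinearMap.coprodEquivL ℝ).continuous.continuousAt.comp
        (h1.prodMk h2))).clm_comp continuousAt_const
    · change ↿Φ₁ (A z) (y' v) + s' v • ε • F (↿Φ (A z)) = _
      rw [hy'v, hs'v, map_zero, zero_add, inv_smul_smul₀ hε]

end FlowBox

section Realizability

variable {E : Type*} [NormedAddCommGroup E] [InnerProductSpace ℝ E] [FiniteDimensional ℝ E]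
  [MeasurableSpace E] [BorelSpace E]

/-- The integral of a directional derivative of a compactly supported `C¹` function vanishes. -/
theorem integral_fderiv_apply_eq_zero {ψ : E → ℝ} (hψ : ContDiff ℝ 1 ψ)
    (hc : HasCompactSupport ψ) (v : E) : ∫ x, fderiv ℝ ψ x v = 0 := by
  have hd : Integrable fun x => fderiv ℝ ψ x v :=
    ((hψ.continuous_fderiv one_ne_zero).clm_apply continuous_const).integrable_of_hasCompactSupport
      (hc.fderiv_apply ℝ v)
  have h := integral_mul_fderiv_eq_neg_fderiv_mul_of_integrable (μ := volume)
    (f := fun _ : E => (1 : ℝ)) (g := ψ) (v := v)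
    (by simp) (by simpa using hd)
    (by simpa using hψ.continuous.integrable_of_hasCompactSupport hc)
    (fun x _ => differentiableAt_const _) (fun x _ => hψ.differentiable one_ne_zero x)
  simpa using h

/-- Pulling back a compactly supported function by an open partial homeomorphism and extending it
by zero gives a compactly supported function. -/
theorem OpenPartialHomeomorph.tsupport_indicator_comp_subset {X Y : Type*} [TopologicalSpace X]
    [T2Space X] [TopologicalSpace Y] (e : OpenPartialHomeomorph X Y) {φ : Y → ℝ}
    (hc : HasCompactSupport φ) (hφ : tsupport φ ⊆ e.target) :
    IsCompact (e.symm '' tsupport φ) ∧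
      tsupport (e.source.indicator (φ ∘ e)) ⊆ e.symm '' tsupport φ := by
  have hK : IsCompact (e.symm '' tsupport φ) :=
    hc.isCompact.image_of_continuousOn (e.continuousOn_symm.mono hφ)
  refine ⟨hK, closure_minimal (fun z hz => ?_) hK.isClosed⟩
  obtain ⟨hzs, hzφ⟩ := indicator_apply_ne_zero.1 hz
  exact ⟨e z, subset_tsupport _ hzφ, e.left_inv hzs⟩

/-- Near a point where it does not vanish, a `C¹` vector field becomes divergence free in the
sense of distributions after multiplication by a suitable positive continuous function. -/
theorem ContDiff.exists_pos_mul_divergenceFree {F : E → E} (hF : ContDiff ℝ 1 F) {x₀ : E}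
    (hx₀ : F x₀ ≠ 0) :
    ∃ V : Set E, IsOpen V ∧ x₀ ∈ V ∧ ∃ σ : E → ℝ, ContinuousOn σ V ∧ (∀ x ∈ V, 0 < σ x) ∧
      ∀ φ : E → ℝ, ContDiff ℝ 1 φ → HasCompactSupport φ → tsupport φ ⊆ V →
        ∫ x in V, σ x * fderiv ℝ φ x (F x) = 0 := by
  have : CompleteSpace E := FiniteDimensional.complete ℝ E
  obtain ⟨T, T', hT₀, hT'₀, hT⟩ := hF.exists_flowBox hx₀
  have hT₀' : HasStrictFDerivAt T (ContinuousLinearEquiv.refl ℝ E : E →L[ℝ] E) x₀ := by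
    have h := hT.self_of_nhds.1
    rw [hT'₀] at h
    exact h
  have hdet : ∀ᶠ z in 𝓝 x₀, (T' z).det ≠ 0 := by
    have h : ContinuousAt (fun z => (T' z).det) x₀ :=
      ContinuousLinearMap.continuous_det.continuousAt.comp hT.self_of_nhds.2.1
    refine h.eventually_ne ?_
    rw [hT'₀]
    simp [ContinuousLinearMap.det]
  obtain ⟨U, hU, hUo, hxU⟩ := eventually_nhds_iff.1 (hT.and hdet)
  let e : OpenPartialHomeomorph E E := (hT₀'.toOpenPartialHomeomorph T).restrOpen U hUo
  have he : ⇑e = T := rfl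
  have hes : e.source ⊆ U := inter_subset_right
  have hxe : x₀ ∈ e.source := ⟨hT₀'.mem_toOpenPartialHomeomorph_source, hxU⟩
  have hsymm {x : E} (hx : x ∈ e.target) : e.symm x ∈ U := hes (e.map_target hx)
  refine ⟨e.target, e.open_target, ?_, fun x => |(T' (e.symm x)).det|⁻¹, ?_, ?_, ?_⟩
  · have := e.map_source hxe
    rwa [he, hT₀] at this
  · intro x hx
    have h := ContinuousLinearMap.continuous_det.continuousAt.comp (hU _ (hsymm hx)).1.2.1
    exact ((h.comp_continuousWithinAt (e.continuousOn_symm x hx)).abs.inv₀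
      (abs_ne_zero.2 (hU _ (hsymm hx)).2))
  · exact fun x hx => inv_pos.2 (abs_pos.2 (hU _ (hsymm hx)).2)
  · intro φ hφ hc hsupp
    obtain ⟨hK, hψK⟩ := e.tsupport_indicator_comp_subset hc hsupp
    set ψ : E → ℝ := e.source.indicator (φ ∘ e)
    have hKs : e.symm '' tsupport φ ⊆ e.source := by
      rintro _ ⟨x, hx, rfl⟩
      exact e.map_target (hsupp hx)
    have hψe {z : E} (hz : z ∈ e.source) : ψ =ᶠ[𝓝 z] φ ∘ T := by
      filter_upwards [e.open_source.mem_nhds hz] with w hw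
      exact indicator_of_mem hw _
    have hψd {z : E} (hz : z ∈ e.source) : HasFDerivAt ψ (fderiv ℝ φ (T z) ∘L T' z) z :=
      ((hφ.differentiable one_ne_zero (T z)).hasFDerivAt.comp z
        (hU z (hes hz)).1.1.hasFDerivAt).congr_of_eventuallyEq (hψe hz)
    have hψ0 {z : E} (hz : z ∉ e.source) : ψ =ᶠ[𝓝 z] 0 :=
      notMem_tsupport_iff_eventuallyEq.1 fun h => hz (hKs (hψK h))
    have hψc : ContDiff ℝ 1 ψ := by
      refine contDiff_one_iff_fderiv.2
        ⟨fun z => ?_, continuous_iff_continuousAt.2 fun z => ?_⟩ <;> by_cases hz : z ∈ e.source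
      · exact (hψd hz).differentiableAt
      · exact (differentiableAt_const (0 : ℝ)).congr_of_eventuallyEq (hψ0 hz)
      · have hc : ContinuousAt (fun w => fderiv ℝ φ (T w) ∘L T' w) z :=
          ((hφ.continuous_fderiv one_ne_zero).continuousAt.comp
            (hU z (hes hz)).1.1.continuousAt).clm_comp (hU z (hes hz)).1.2.1
        refine hc.congr ?_
        filter_upwards [e.open_source.mem_nhds hz] with w hw
        exact (hψd hw).fderiv.symm
      · refine (continuousAt_const (y := (0 : E →L[ℝ] ℝ))).congr ?_
        filter_upwards [(hψ0 hz).fderiv (𝕜 := ℝ)] with w hw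
        rw [hw, fderiv_zero]
        rfl
    have hcψ : HasCompactSupport ψ := hK.of_isClosed_subset (isClosed_tsupport _) hψK
    have hout {z : E} (hz : z ∉ e.source) : fderiv ℝ ψ z (F x₀) = 0 := by
      rw [(hψ0 hz).fderiv_eq, fderiv_zero]
      rfl
    calc ∫ x in e.target, |(T' (e.symm x)).det|⁻¹ * fderiv ℝ φ x (F x)
        = ∫ x in T '' e.source, |(T' (e.symm x)).det|⁻¹ * fderiv ℝ φ x (F x) := by
          rw [← he, e.image_source_eq_target]
      _ = ∫ z in e.source, |(T' z).det| •
            (|(T' (e.symm (T z))).det|⁻¹ * fderiv ℝ φ (T z) (F (T z))) :=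
          integral_image_eq_integral_abs_det_fderiv_smul volume e.open_source.measurableSet
            (fun z hz => (hU z (hes hz)).1.1.hasFDerivAt.hasFDerivWithinAt) e.injOn _
      _ = ∫ z in e.source, fderiv ℝ ψ z (F x₀) := by
          refine setIntegral_congr_fun e.open_source.measurableSet fun z hz => ?_
          have h1 : e.symm (T z) = z := e.left_inv hz
          have h2 := abs_ne_zero.2 (hU z (hes hz)).2
          simp only [h1, (hψd hz).fderiv, ContinuousLinearMap.comp_apply,
            (hU z (hes hz)).1.2.2, smul_eq_mul, mul_inv_cancel_left₀ h2]
      _ = ∫ z, fderiv ℝ ψ z (F x₀) :=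
          setIntegral_eq_integral_of_forall_compl_eq_zero fun z hz => hout hz
      _ = 0 := integral_fderiv_apply_eq_zero hψc hcψ _

end Realizability

/-- **Theorem 2.1(i)** (local isotropic realizability): if `u` is `C²` on `ℝ^d`, `d ≥ 2`,
and `∇u(x₀) ≠ 0`, then there is an open neighborhood `V` of `x₀` and a continuous positive
function `σ` on `V` such that `σ ∇u` is divergence free in `V` in the sense of
distributions. -/
theorem local_isotropic_realizability (d : ℕ) (hd : 2 ≤ d)
    (u : EuclideanSpace ℝ (Fin d) → ℝ) (hu : ContDiff ℝ 2 u)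
    (x₀ : EuclideanSpace ℝ (Fin d)) (hx₀ : gradient u x₀ ≠ 0) :
    ∃ V : Set (EuclideanSpace ℝ (Fin d)), IsOpen V ∧ x₀ ∈ V ∧
      ∃ σ : EuclideanSpace ℝ (Fin d) → ℝ, ContinuousOn σ V ∧ (∀ x ∈ V, 0 < σ x) ∧
        ∀ φ : EuclideanSpace ℝ (Fin d) → ℝ, ContDiff ℝ (⊤ : ℕ∞) φ → HasCompactSupport φ →
          tsupport φ ⊆ V →
          (∫ x in V, σ x * ⟪gradient u x, gradient φ x⟫) = 0 := by
  have hgrad (v : EuclideanSpace ℝ (Fin d) → ℝ) (x w : EuclideanSpace ℝ (Fin d)) :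
      ⟪w, gradient v x⟫ = fderiv ℝ v x w := by
    rw [real_inner_comm, gradient, InnerProductSpace.toDual_symm_apply]
  have hF : ContDiff ℝ 1 (gradient u) :=
    (InnerProductSpace.toDual ℝ (EuclideanSpace ℝ (Fin d))).symm.contDiff.comp
      (hu.fderiv_right (m := 1) (by norm_num))
  obtain ⟨V, hV, hxV, σ, hσ, hpos, h⟩ := hF.exists_pos_mul_divergenceFree hx₀
  refine ⟨V, hV, hxV, σ, hσ, hpos, fun φ hφ hc hsupp => ?_⟩
  simp only [hgrad]
  exact h φ (hφ.of_le (by exact_mod_cast le_top)) hc hsupp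
end

section
/- Let u : ℝ² → ℝ be continuously differentiable with ∇u ℤ²-periodic and ⟨∇u⟩ ≠ 0. Suppose σ : ℝ² → ℝ^{2×2} is an infinitely differentiable, ℤ²-periodic, symmetric matrix-valued function with σ(x) positive definite for every x, such that div(σ∇u) = 0 in the sense of distributions on ℝ², i.e. ∫_{ℝ²} (σ(x)∇u(x)) · ∇φ(x) dx = 0 for all φ ∈ C_c^∞(ℝ²). Then ∇u(x) ≠ 0 for every x ∈ ℝ². (Theorem 2.1(ii).) -/
open MeasureTheory
open scoped RealInnerProductSpace

namespace PeriodicGradient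

open Set

/-- The closed unit square. -/
abbrev cell : Set (ℝ × ℝ) := Icc (0, 0) (1, 1)

/-- Periodicity with respect to the integer lattice, expressed through its two generators. -/
def UnitPeriodic {α : Type*} (f : ℝ × ℝ → α) : Prop :=
  (∀ x, f (x + (1, 0)) = f x) ∧ ∀ x, f (x + (0, 1)) = f x

/-- The first partial derivative. -/
noncomputable def d₁ (f : ℝ × ℝ → ℝ) (x : ℝ × ℝ) : ℝ := fderiv ℝ f x (1, 0)

/-- The second partial derivative. -/
noncomputable def d₂ (f : ℝ × ℝ → ℝ) (x : ℝ × ℝ) : ℝ := fderiv ℝ f x (0, 1)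

lemma cell_eq_prod : cell = Icc (0 : ℝ) 1 ×ˢ Icc (0 : ℝ) 1 := (Icc_prod_Icc 0 1 0 1).symm

lemma isCompact_cell : IsCompact cell := isCompact_Icc

lemma volume_cell : volume cell = 1 := by
  rw [cell_eq_prod, Measure.volume_eq_prod, Measure.prod_prod]
  simp

instance : IsProbabilityMeasure (volume.restrict cell) :=
  ⟨by rw [Measure.restrict_apply_univ, volume_cell]⟩

lemma integrableOn_cell {f : ℝ × ℝ → ℝ} (hf : Continuous f) : IntegrableOn f cell :=
  hf.continuousOn.integrableOn_compact isCompact_cell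

lemma continuous_d₁ {f : ℝ × ℝ → ℝ} (hf : ContDiff ℝ 1 f) : Continuous (d₁ f) :=
  (hf.continuous_fderiv one_ne_zero).clm_apply continuous_const

lemma continuous_d₂ {f : ℝ × ℝ → ℝ} (hf : ContDiff ℝ 1 f) : Continuous (d₂ f) :=
  (hf.continuous_fderiv one_ne_zero).clm_apply continuous_const

lemma setIntegral_cell_eq {f : ℝ × ℝ → ℝ} (hf : Continuous f) :
    ∫ x in cell, f x = ∫ x in (0 : ℝ)..1, ∫ y in (0 : ℝ)..1, f (x, y) := by
  have h := integrableOn_cell hf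
  rw [cell_eq_prod, Measure.volume_eq_prod] at h ⊢
  rw [setIntegral_prod _ h, intervalIntegral.integral_of_le zero_le_one,
    integral_Icc_eq_integral_Ioc]
  simp_rw [integral_Icc_eq_integral_Ioc, intervalIntegral.integral_of_le (zero_le_one' ℝ)]

lemma setIntegral_cell_eq' {f : ℝ × ℝ → ℝ} (hf : Continuous f) :
    ∫ x in cell, f x = ∫ y in (0 : ℝ)..1, ∫ x in (0 : ℝ)..1, f (x, y) := by
  have h := integrableOn_cell hf
  rw [cell_eq_prod, IntegrableOn, Measure.volume_eq_prod, ← Measure.prod_restrict] at h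
  rw [cell_eq_prod, Measure.volume_eq_prod, ← Measure.prod_restrict, integral_prod_symm _ h,
    intervalIntegral.integral_of_le zero_le_one, integral_Icc_eq_integral_Ioc]
  simp_rw [integral_Icc_eq_integral_Ioc, intervalIntegral.integral_of_le (zero_le_one' ℝ)]

/-- The integral over the unit square of the divergence of a periodic field vanishes. -/
lemma setIntegral_cell_divergence {f g : ℝ × ℝ → ℝ} (hf : Differentiable ℝ f)
    (hg : Differentiable ℝ g) (pf : UnitPeriodic f) (pg : UnitPeriodic g)
    (hc : Continuous fun x => d₁ f x + d₂ g x) : ∫ x in cell, (d₁ f x + d₂ g x) = 0 := by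
  have := integral_divergence_prod_Icc_of_hasFDerivAt_of_le f g (fderiv ℝ f) (fderiv ℝ g)
    (0, 0) (1, 1) (by simp [Prod.le_def]) hf.continuous.continuousOn hg.continuous.continuousOn
    (fun x _ => (hf x).hasFDerivAt) (fun x _ => (hg x).hasFDerivAt) (integrableOn_cell hc)
  have h1 : ∀ y : ℝ, f (1, y) = f (0, y) := fun y => by simpa using pf.1 (0, y)
  have h2 : ∀ x : ℝ, g (x, 1) = g (x, 0) := fun x => by simpa using pg.2 (x, 0)
  simpa [h1, h2, cell, d₁, d₂] using this

/-- A Gagliardo-Nirenberg type inequality on the unit square, for functions vanishing on a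
smaller square. -/
lemma setIntegral_cell_sq_le {f : ℝ × ℝ → ℝ} (hf : ContDiff ℝ 1 f) (h0 : ∀ x, 0 ≤ f x)
    {a b l : ℝ} (ha : 0 ≤ a) (hb : 0 ≤ b) (hl : 0 < l) (hal : a + l ≤ 1) (hbl : b + l ≤ 1)
    (hz : ∀ x ∈ Icc a (a + l), ∀ y ∈ Icc b (b + l), f (x, y) = 0) :
    ∫ x in cell, f x ^ 2 ≤ (1 + 1 / l) ^ 2 * (∫ x in cell, (|d₁ f x| + |d₂ f x|)) ^ 2 := by
  have c1 := (continuous_d₁ hf).abs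
  have c2 := (continuous_d₂ hf).abs
  set A : ℝ → ℝ := fun y => ∫ t in (0 : ℝ)..1, |d₁ f (t, y)|
  set B : ℝ → ℝ := fun x => ∫ t in (0 : ℝ)..1, |d₂ f (x, t)|
  have cA : Continuous A :=
    intervalIntegral.continuous_parametric_intervalIntegral_of_continuous'
      (f := fun y t => |d₁ f (t, y)|) (c1.comp (continuous_snd.prodMk continuous_fst)) 0 1
  have cB : Continuous B :=
    intervalIntegral.continuous_parametric_intervalIntegral_of_continuous' c2 0 1
  have hA0 : ∀ y, 0 ≤ A y := fun y =>
    intervalIntegral.integral_nonneg zero_le_one fun _ _ => abs_nonneg _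
  have hB0 : ∀ y, 0 ≤ B y := fun y =>
    intervalIntegral.integral_nonneg zero_le_one fun _ _ => abs_nonneg _
  set α := ∫ y in (0 : ℝ)..1, A y
  set β := ∫ x in (0 : ℝ)..1, B x
  have hE : ∫ x in cell, (|d₁ f x| + |d₂ f x|) = α + β := by
    rw [integral_add (integrableOn_cell c1) (integrableOn_cell c2), setIntegral_cell_eq' c1,
      setIntegral_cell_eq c2]
  have hα : 0 ≤ α := intervalIntegral.integral_nonneg zero_le_one fun _ _ => hA0 _
  have hβ : 0 ≤ β := intervalIntegral.integral_nonneg zero_le_one fun _ _ => hB0 _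
  have sub : ∀ {φ : ℝ → ℝ}, Continuous φ → (∀ t, 0 ≤ φ t) → ∀ s ∈ Icc (0 : ℝ) 1,
      ∀ t ∈ Icc (0 : ℝ) 1, |∫ r in s..t, φ r| ≤ ∫ r in (0 : ℝ)..1, φ r := by
    intro φ hφ hφ0 s hs t ht
    refine intervalIntegral.abs_integral_mono_interval ?_ (.of_forall hφ0)
      (hφ.intervalIntegrable _ _) |>.trans_eq
      (abs_of_nonneg (intervalIntegral.integral_nonneg zero_le_one fun _ _ => hφ0 _))
    rw [uIoc_of_le zero_le_one, uIoc]
    exact Ioc_subset_Ioc (le_min hs.1 ht.1) (max_le hs.2 ht.2)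
  have hx : ∀ x ∈ Icc (0 : ℝ) 1, ∀ x' ∈ Icc (0 : ℝ) 1, ∀ y, f (x, y) ≤ f (x', y) + A y := by
    intro x hx x' hx' y
    have hd : ∀ t, HasDerivAt (fun t => f (t, y)) (d₁ f (t, y)) t := fun t =>
      ((hf.differentiable one_ne_zero (t, y)).hasFDerivAt).comp_hasDerivAt t
        ((hasDerivAt_id t).prodMk (hasDerivAt_const t y))
    have c1' : Continuous fun t => d₁ f (t, y) := (continuous_d₁ hf).comp (by fun_prop)
    have := intervalIntegral.integral_eq_sub_of_hasDerivAt (a := x') (b := x)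
      (fun t _ => hd t) (c1'.intervalIntegrable _ _)
    have h2 := (intervalIntegral.norm_integral_le_abs_integral_norm
      (f := fun t => d₁ f (t, y)) (a := x') (b := x) (μ := volume)).trans
        (sub c1'.abs (fun _ => abs_nonneg _) x' hx' x hx)
    rw [this] at h2
    linarith [(le_abs_self _).trans h2, show A y = ∫ t in (0 : ℝ)..1, |d₁ f (t, y)| from rfl]
  have hy : ∀ y ∈ Icc (0 : ℝ) 1, ∀ y' ∈ Icc (0 : ℝ) 1, ∀ x, f (x, y) ≤ f (x, y') + B x := by
    intro y hy y' hy' x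
    have hd : ∀ t, HasDerivAt (fun t => f (x, t)) (d₂ f (x, t)) t := fun t =>
      ((hf.differentiable one_ne_zero (x, t)).hasFDerivAt).comp_hasDerivAt t
        ((hasDerivAt_const t x).prodMk (hasDerivAt_id t))
    have c1' : Continuous fun t => d₂ f (x, t) := (continuous_d₂ hf).comp (by fun_prop)
    have := intervalIntegral.integral_eq_sub_of_hasDerivAt (a := y') (b := y)
      (fun t _ => hd t) (c1'.intervalIntegrable _ _)
    have h2 := (intervalIntegral.norm_integral_le_abs_integral_norm
      (f := fun t => d₂ f (x, t)) (a := y') (b := y) (μ := volume)).trans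
        (sub c1'.abs (fun _ => abs_nonneg _) y' hy' y hy)
    rw [this] at h2
    linarith [(le_abs_self _).trans h2, show B x = ∫ t in (0 : ℝ)..1, |d₂ f (x, t)| from rfl]
  have mean : ∀ {φ : ℝ → ℝ}, Continuous φ → (∀ t, 0 ≤ φ t) → ∀ {s v w : ℝ}, 0 ≤ s → s + l ≤ 1 →
      (∀ t ∈ Icc s (s + l), v ≤ w + φ t) → v ≤ w + (∫ t in (0 : ℝ)..1, φ t) / l := by
    intro φ hφ hφ0 s v w hs hsl h
    have h1 : ∫ t in s..(s + l), (v - w) ≤ ∫ t in s..(s + l), φ t :=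
      intervalIntegral.integral_mono_on (by linarith) (by simp) (hφ.intervalIntegrable _ _)
        fun t ht => by linarith [h t ht]
    have h2 := (le_abs_self _).trans
      (sub hφ hφ0 s ⟨hs, by linarith⟩ (s + l) ⟨by linarith, hsl⟩)
    rw [intervalIntegral.integral_const, add_sub_cancel_left, smul_eq_mul] at h1
    have : v - w ≤ (∫ t in (0 : ℝ)..1, φ t) / l := by
      rw [le_div_iff₀ hl]; linarith
    linarith
  have key1 : ∀ x ∈ Icc (0 : ℝ) 1, ∀ y ∈ Icc (0 : ℝ) 1, f (x, y) ≤ A y + β / l := by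
    intro x hxm y hym
    refine mean cB hB0 ha hal fun t ht => ?_
    have ht' : t ∈ Icc (0 : ℝ) 1 := ⟨ha.trans ht.1, ht.2.trans hal⟩
    have h1 := hx x hxm t ht' y
    have h2 := hy y hym b ⟨hb, by linarith⟩ t
    rw [hz t ht b ⟨le_rfl, by linarith⟩] at h2
    linarith
  have key2 : ∀ x ∈ Icc (0 : ℝ) 1, ∀ y ∈ Icc (0 : ℝ) 1, f (x, y) ≤ B x + α / l := by
    intro x hxm y hym
    refine mean cA hA0 hb hbl fun t ht => ?_
    have ht' : t ∈ Icc (0 : ℝ) 1 := ⟨hb.trans ht.1, ht.2.trans hbl⟩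
    have h1 := hy y hym t ht' x
    have h2 := hx x hxm a ⟨ha, by linarith⟩ t
    rw [hz a ⟨le_rfl, by linarith⟩ t ht] at h2
    linarith
  have hprod : Continuous fun x : ℝ × ℝ => (B x.1 + α / l) * (A x.2 + β / l) := by fun_prop
  have cf := hf.continuous
  calc ∫ x in cell, f x ^ 2 ≤ ∫ x in cell, (B x.1 + α / l) * (A x.2 + β / l) := by
        refine setIntegral_mono_on (integrableOn_cell (by fun_prop)) (integrableOn_cell hprod)
          measurableSet_Icc fun x hx => ?_
        have hx' : x ∈ Icc (0 : ℝ) 1 ×ˢ Icc (0 : ℝ) 1 := cell_eq_prod ▸ hx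
        rw [sq]
        exact mul_le_mul (key2 x.1 hx'.1 x.2 hx'.2) (key1 x.1 hx'.1 x.2 hx'.2) (h0 _)
          (add_nonneg (hB0 _) (by positivity))
    _ = (β + α / l) * (α + β / l) := by
        rw [setIntegral_cell_eq hprod]
        simp only [intervalIntegral.integral_const_mul, intervalIntegral.integral_mul_const]
        rw [intervalIntegral.integral_add (cB.intervalIntegrable _ _) (by simp),
          intervalIntegral.integral_add (cA.intervalIntegrable _ _) (by simp)]
        simp [α, β]
    _ ≤ ((1 + 1 / l) * (α + β)) * ((1 + 1 / l) * (α + β)) := by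
        have h1 : 0 ≤ α / l := by positivity
        have h2 : 0 ≤ β / l := by positivity
        have e : (1 + 1 / l) * (α + β) = α + β + α / l + β / l := by ring
        rw [e]
        apply mul_le_mul <;> first | positivity | linarith
    _ = _ := by rw [hE]; ring

lemma UnitPeriodic.fderiv {F : Type*} [NormedAddCommGroup F] [NormedSpace ℝ F] {f : ℝ × ℝ → F}
    (hf : UnitPeriodic f) : UnitPeriodic (fderiv ℝ f) := by
  constructor <;> intro x <;> rw [← fderiv_comp_add_right]
  · simp_rw [hf.1]
  · simp_rw [hf.2]

lemma UnitPeriodic.comp {α β : Type*} {f : ℝ × ℝ → α} (hf : UnitPeriodic f) (φ : α → β) :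
    UnitPeriodic fun x => φ (f x) :=
  ⟨fun x => congrArg φ (hf.1 x), fun x => congrArg φ (hf.2 x)⟩

lemma UnitPeriodic.comp₂ {α β γ : Type*} {f : ℝ × ℝ → α} {g : ℝ × ℝ → β} (hf : UnitPeriodic f)
    (hg : UnitPeriodic g) (φ : α → β → γ) : UnitPeriodic fun x => φ (f x) (g x) :=
  ⟨fun x => congrArg₂ φ (hf.1 x) (hg.1 x), fun x => congrArg₂ φ (hf.2 x) (hg.2 x)⟩

lemma UnitPeriodic.d₁ {f : ℝ × ℝ → ℝ} (hf : UnitPeriodic f) : UnitPeriodic (d₁ f) :=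
  hf.fderiv.comp fun L => L (1, 0)

lemma UnitPeriodic.d₂ {f : ℝ × ℝ → ℝ} (hf : UnitPeriodic f) : UnitPeriodic (d₂ f) :=
  hf.fderiv.comp fun L => L (0, 1)

lemma contDiff_d₁ {f : ℝ × ℝ → ℝ} (hf : ContDiff ℝ 2 f) : ContDiff ℝ 1 (d₁ f) :=
  (hf.fderiv_right (m := 1) (by norm_num)).clm_apply contDiff_const

lemma contDiff_d₂ {f : ℝ × ℝ → ℝ} (hf : ContDiff ℝ 2 f) : ContDiff ℝ 1 (d₂ f) :=
  (hf.fderiv_right (m := 1) (by norm_num)).clm_apply contDiff_const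

lemma d₁_d₂_comm {f : ℝ × ℝ → ℝ} (hf : ContDiff ℝ 2 f) (x : ℝ × ℝ) :
    d₁ (d₂ f) x = d₂ (d₁ f) x := by
  have hd : DifferentiableAt ℝ (fderiv ℝ f) x :=
    (hf.fderiv_right (m := 1) (by norm_num)).differentiable one_ne_zero x
  have hs : IsSymmSndFDerivAt ℝ f x := hf.contDiffAt.isSymmSndFDerivAt (by simp)
  have h1 := (hd.hasFDerivAt.clm_apply (hasFDerivAt_const ((0 : ℝ), (1 : ℝ)) x)).fderiv
  have h2 := (hd.hasFDerivAt.clm_apply (hasFDerivAt_const ((1 : ℝ), (0 : ℝ)) x)).fderiv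
  unfold d₁ d₂
  rw [h1, h2]
  simpa using hs (1, 0) (0, 1)

lemma d₁_mul {f g : ℝ × ℝ → ℝ} (hf : Differentiable ℝ f) (hg : Differentiable ℝ g)
    (x : ℝ × ℝ) : d₁ (fun x => f x * g x) x = d₁ f x * g x + f x * d₁ g x := by
  rw [d₁, fderiv_fun_mul (hf x) (hg x)]
  simp [d₁]
  ring

lemma d₂_mul {f g : ℝ × ℝ → ℝ} (hf : Differentiable ℝ f) (hg : Differentiable ℝ g)
    (x : ℝ × ℝ) : d₂ (fun x => f x * g x) x = d₂ f x * g x + f x * d₂ g x := by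
  rw [d₂, fderiv_fun_mul (hf x) (hg x)]
  simp [d₂]
  ring

lemma d₁_add {f g : ℝ × ℝ → ℝ} (hf : Differentiable ℝ f) (hg : Differentiable ℝ g)
    (x : ℝ × ℝ) : d₁ (fun x => f x + g x) x = d₁ f x + d₁ g x := by
  rw [d₁, fderiv_fun_add (hf x) (hg x)]
  rfl

lemma d₂_add {f g : ℝ × ℝ → ℝ} (hf : Differentiable ℝ f) (hg : Differentiable ℝ g)
    (x : ℝ × ℝ) : d₂ (fun x => f x + g x) x = d₂ f x + d₂ g x := by
  rw [d₂, fderiv_fun_add (hf x) (hg x)]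
  rfl

lemma d₁_sub {f g : ℝ × ℝ → ℝ} (hf : Differentiable ℝ f) (hg : Differentiable ℝ g)
    (x : ℝ × ℝ) : d₁ (fun x => f x - g x) x = d₁ f x - d₁ g x := by
  rw [d₁, fderiv_fun_sub (hf x) (hg x)]
  rfl

lemma d₂_sub {f g : ℝ × ℝ → ℝ} (hf : Differentiable ℝ f) (hg : Differentiable ℝ g)
    (x : ℝ × ℝ) : d₂ (fun x => f x - g x) x = d₂ f x - d₂ g x := by
  rw [d₂, fderiv_fun_sub (hf x) (hg x)]
  rfl

lemma d₁_comp {φ φ' : ℝ → ℝ} {f : ℝ × ℝ → ℝ} (hφ : ∀ t, HasDerivAt φ (φ' t) t)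
    (hf : Differentiable ℝ f) (x : ℝ × ℝ) : d₁ (fun x => φ (f x)) x = φ' (f x) * d₁ f x := by
  have := ((hφ (f x)).comp_hasFDerivAt x (hf x).hasFDerivAt).fderiv
  rw [d₁, show (fun x => φ (f x)) = φ ∘ f from rfl, this]
  simp [d₁]

lemma d₂_comp {φ φ' : ℝ → ℝ} {f : ℝ × ℝ → ℝ} (hφ : ∀ t, HasDerivAt φ (φ' t) t)
    (hf : Differentiable ℝ f) (x : ℝ × ℝ) : d₂ (fun x => φ (f x)) x = φ' (f x) * d₂ f x := by
  have := ((hφ (f x)).comp_hasFDerivAt x (hf x).hasFDerivAt).fderiv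
  rw [d₂, show (fun x => φ (f x)) = φ ∘ f from rfl, this]
  simp [d₂]

/-- The squared length of the planar field with components `g` and `h`. -/
def normSq (g h : ℝ × ℝ → ℝ) (x : ℝ × ℝ) : ℝ := g x * g x + h x * h x

lemma normSq_nonneg (g h : ℝ × ℝ → ℝ) (x : ℝ × ℝ) : 0 ≤ normSq g h x :=
  add_nonneg (mul_self_nonneg _) (mul_self_nonneg _)

lemma contDiff_normSq {n : WithTop ℕ∞} {g h : ℝ × ℝ → ℝ} (hg : ContDiff ℝ n g)
    (hh : ContDiff ℝ n h) : ContDiff ℝ n (normSq g h) :=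
  (hg.mul hg).add (hh.mul hh)

lemma d₁_normSq {g h : ℝ × ℝ → ℝ} (dg : Differentiable ℝ g) (dh : Differentiable ℝ h)
    (x : ℝ × ℝ) : d₁ (normSq g h) x = 2 * (g x * d₁ g x + h x * d₁ h x) := by
  unfold normSq
  rw [d₁_add (dg.fun_mul dg) (dh.fun_mul dh), d₁_mul dg dg, d₁_mul dh dh]
  ring

lemma d₂_normSq {g h : ℝ × ℝ → ℝ} (dg : Differentiable ℝ g) (dh : Differentiable ℝ h)
    (x : ℝ × ℝ) : d₂ (normSq g h) x = 2 * (g x * d₂ g x + h x * d₂ h x) := by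
  unfold normSq
  rw [d₂_add (dg.fun_mul dg) (dh.fun_mul dh), d₂_mul dg dg, d₂_mul dh dh]
  ring

/-- The Jacobian of a periodic planar map, weighted by a function of its squared length vanishing
near zero, has zero integral over a period. -/
lemma setIntegral_cell_jacobian {g h : ℝ × ℝ → ℝ} (hg : ContDiff ℝ 2 g) (hh : ContDiff ℝ 2 h)
    (pg : UnitPeriodic g) (ph : UnitPeriodic h) {ψ Ψ : ℝ → ℝ} (cψ : Continuous ψ)
    (hΨ : ∀ t, HasDerivAt Ψ (ψ t) t) {p : ℝ} (hp : 0 < p) (h0 : ∀ t ≤ p, Ψ t = 0) :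
    ∫ x in cell, ψ (normSq g h x) * (d₁ g x * d₂ h x - d₂ g x * d₁ h x) = 0 := by
  have hψ0 : ∀ t < p, ψ t = 0 := fun t ht => by
    refine (hΨ t).unique (HasDerivAt.congr_of_eventuallyEq (hasDerivAt_const t 0) ?_)
    filter_upwards [Iio_mem_nhds ht] with s hs using h0 s hs.le
  set Φ : ℝ → ℝ := fun s => Ψ s / (2 * s)
  set Φ' : ℝ → ℝ := fun s => (ψ s * (2 * s) - Ψ s * 2) / (2 * s) ^ 2
  have hΦ : ∀ t, HasDerivAt Φ (Φ' t) t := by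
    intro t
    rcases lt_or_ge t p with ht | ht
    · have : Φ' t = 0 := by simp [Φ', hψ0 t ht, h0 t ht.le]
      rw [this]
      refine HasDerivAt.congr_of_eventuallyEq (hasDerivAt_const t 0) ?_
      filter_upwards [Iio_mem_nhds ht] with s hs
      simp [Φ, h0 s (le_of_lt hs)]
    · have ht' : 0 < t := hp.trans_le ht
      have h2 : HasDerivAt (fun s : ℝ => 2 * s) 2 t := by simpa using (hasDerivAt_id t).const_mul 2
      exact (hΨ t).div h2 (by positivity)
  have hΦψ : ∀ t, 2 * (t * Φ' t + Φ t) = ψ t := by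
    intro t
    rcases eq_or_ne t 0 with rfl | ht
    · simp [Φ, hψ0 0 hp]
    · simp only [Φ, Φ']
      field_simp
      ring
  have dg := hg.differentiable two_ne_zero
  have dh := hh.differentiable two_ne_zero
  have dg1 := (contDiff_d₁ hg).differentiable one_ne_zero
  have dh1 := (contDiff_d₁ hh).differentiable one_ne_zero
  have dg2 := (contDiff_d₂ hg).differentiable one_ne_zero
  have dh2 := (contDiff_d₂ hh).differentiable one_ne_zero
  have ds : Differentiable ℝ (normSq g h) := (dg.fun_mul dg).add (dh.fun_mul dh)
  have dΦ : Differentiable ℝ fun x => Φ (normSq g h x) := fun x =>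
    (hΦ _).differentiableAt.comp x (ds x)
  have s1 := d₁_normSq dg dh
  have s2 := d₂_normSq dg dh
  set F : ℝ × ℝ → ℝ := fun x => Φ (normSq g h x) * (g x * d₂ h x - h x * d₂ g x)
  set G : ℝ × ℝ → ℝ := fun x => Φ (normSq g h x) * (h x * d₁ g x - g x * d₁ h x)
  have e : ∀ x, d₁ F x + d₂ G x
      = ψ (normSq g h x) * (d₁ g x * d₂ h x - d₂ g x * d₁ h x) := by
    intro x
    simp only [F, G]
    rw [d₁_mul dΦ ((dg.fun_mul dh2).fun_sub (dh.fun_mul dg2)),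
      d₂_mul dΦ ((dh.fun_mul dg1).fun_sub (dg.fun_mul dh1)),
      d₁_comp hΦ ds, d₂_comp hΦ ds, s1, s2, d₁_sub (dg.fun_mul dh2) (dh.fun_mul dg2),
      d₂_sub (dh.fun_mul dg1) (dg.fun_mul dh1), d₁_mul dg dh2, d₁_mul dh dg2, d₂_mul dh dg1,
      d₂_mul dg dh1, d₁_d₂_comm hg, d₁_d₂_comm hh, ← hΦψ]
    unfold normSq
    ring
  have pS : UnitPeriodic (normSq g h) := pg.comp₂ ph fun a b => a * a + b * b
  have pF : UnitPeriodic F :=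
    pS.comp₂ ((pg.comp₂ ph.d₂ (· * ·)).comp₂ (ph.comp₂ pg.d₂ (· * ·)) (· - ·)) (Φ · * ·)
  have pG : UnitPeriodic G :=
    pS.comp₂ ((ph.comp₂ pg.d₁ (· * ·)).comp₂ (pg.comp₂ ph.d₁ (· * ·)) (· - ·)) (Φ · * ·)
  have c1 := continuous_d₁ (hg.of_le one_le_two)
  have c2 := continuous_d₂ (hg.of_le one_le_two)
  have c3 := continuous_d₁ (hh.of_le one_le_two)
  have c4 := continuous_d₂ (hh.of_le one_le_two)
  have cs := ds.continuous
  have := setIntegral_cell_divergence (f := F) (g := G)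
    (dΦ.mul ((dg.fun_mul dh2).fun_sub (dh.fun_mul dg2)))
    (dΦ.mul ((dh.fun_mul dg1).fun_sub (dg.fun_mul dh1))) pF pG
    (by simp_rw [e]; fun_prop)
  simpa only [e] using this

/-- The main a priori estimate, for a smooth periodic field which is almost curl free and
quasiconformal up to lower order terms. -/
lemma setIntegral_cell_truncation_sq_le {g h : ℝ × ℝ → ℝ} (hg : ContDiff ℝ 2 g)
    (hh : ContDiff ℝ 2 h) (pg : UnitPeriodic g) (ph : UnitPeriodic h)
    (curl : ∀ x, d₂ g x = d₁ h x) {K K' η : ℝ}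
    (hqc : ∀ x, d₁ g x ^ 2 + d₂ g x ^ 2 + d₂ h x ^ 2 ≤
      -K * (d₁ g x * d₂ h x - d₂ g x * d₁ h x) + K' * (normSq g h x + η))
    (hη : 0 ≤ η)
    {ψ Ψ : ℝ → ℝ} (cψ : Continuous ψ) (hψ : ∀ t, 0 ≤ ψ t)
    (hΨ : ∀ t, HasDerivAt Ψ (ψ t) t) {p P M : ℝ} (hp : 0 < p) (h0 : ∀ t ≤ p, Ψ t = 0)
    (hM : ∀ t, P ≤ t → Ψ t = M) (hΨM : ∀ t, Ψ t ≤ M)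
    {a b l : ℝ} (ha : 0 ≤ a) (hb : 0 ≤ b) (hl : 0 < l) (hal : a + l ≤ 1) (hbl : b + l ≤ 1)
    (hz : ∀ x ∈ Icc a (a + l), ∀ y ∈ Icc b (b + l), P ≤ normSq g h (x, y)) :
    ∫ x in cell, (M - Ψ (normSq g h x)) ^ 2 ≤
      ((1 + 1 / l) * (2 + 2 * K')) ^ 2
        * (∫ x in cell, ψ (normSq g h x) * (normSq g h x + η)) ^ 2 := by
  have dg := hg.differentiable two_ne_zero
  have dh := hh.differentiable two_ne_zero
  have ds : Differentiable ℝ (normSq g h) := (dg.fun_mul dg).add (dh.fun_mul dh)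
  have c1 := continuous_d₁ (hg.of_le one_le_two)
  have c2 := continuous_d₂ (hg.of_le one_le_two)
  have c3 := continuous_d₁ (hh.of_le one_le_two)
  have c4 := continuous_d₂ (hh.of_le one_le_two)
  have cs := ds.continuous
  have cΨ : ContDiff ℝ 1 Ψ := by
    rw [contDiff_one_iff_deriv]
    refine ⟨fun t => (hΨ t).differentiableAt, ?_⟩
    rwa [show deriv Ψ = ψ from funext fun t => (hΨ t).deriv]
  have cT : ContDiff ℝ 1 fun x => M - Ψ (normSq g h x) :=
    contDiff_const.sub (cΨ.comp ((contDiff_normSq hg hh).of_le one_le_two))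
  have s1 := d₁_normSq dg dh
  have s2 := d₂_normSq dg dh
  have hd : ∀ t, HasDerivAt (fun t => M - Ψ t) (-ψ t) t := fun t => (hΨ t).const_sub M
  refine (setIntegral_cell_sq_le cT (fun x => sub_nonneg.2 (hΨM _)) ha hb hl hal hbl
    fun x hx y hy => ?_).trans ?_
  · rw [hM _ (hz x hx y hy), sub_self]
  rw [mul_pow (1 + 1 / l) (2 + 2 * K'), mul_assoc, ← mul_pow (2 + 2 * K')]
  refine mul_le_mul_of_nonneg_left (pow_le_pow_left₀ ?_ ?_ 2) (by positivity)
  · exact integral_nonneg fun x => by positivity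
  have hJ := setIntegral_cell_jacobian hg hh pg ph cψ hΨ hp h0
  have i1 : IntegrableOn
      (fun x => ψ (normSq g h x) * (d₁ g x * d₂ h x - d₂ g x * d₁ h x)) cell :=
    integrableOn_cell (by fun_prop)
  have i2 : IntegrableOn (fun x => ψ (normSq g h x) * (normSq g h x + η)) cell :=
    integrableOn_cell (by fun_prop)
  have cc1 := continuous_d₁ cT
  have cc2 := continuous_d₂ cT
  calc _ ≤ ∫ x in cell, ((2 + 2 * K') * (ψ (normSq g h x) * (normSq g h x + η))
        - 2 * K * (ψ (normSq g h x) * (d₁ g x * d₂ h x - d₂ g x * d₁ h x))) := by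
        refine integral_mono (integrableOn_cell (by fun_prop)) ?_ fun x => ?_
        · exact (i2.const_mul _).sub (i1.const_mul _)
        simp only
        rw [d₁_comp hd ds, d₂_comp hd ds, s1, s2, neg_mul, neg_mul, abs_neg, abs_neg,
          abs_mul (ψ _), abs_mul (ψ _), abs_of_nonneg (hψ _), ← mul_add]
        have h1 : |2 * (g x * d₁ g x + h x * d₁ h x)| ≤
            normSq g h x + d₁ g x ^ 2 + d₁ h x ^ 2 := by
          unfold normSq
          rw [abs_le]
          constructor <;> nlinarith [sq_nonneg (g x - d₁ g x), sq_nonneg (g x + d₁ g x),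
            sq_nonneg (h x - d₁ h x), sq_nonneg (h x + d₁ h x)]
        have h2 : |2 * (g x * d₂ g x + h x * d₂ h x)| ≤
            normSq g h x + d₂ g x ^ 2 + d₂ h x ^ 2 := by
          unfold normSq
          rw [abs_le]
          constructor <;> nlinarith [sq_nonneg (g x - d₂ g x), sq_nonneg (g x + d₂ g x),
            sq_nonneg (h x - d₂ h x), sq_nonneg (h x + d₂ h x)]
        have h3 := hqc x
        have h4 := curl x
        have h5 : |2 * (g x * d₁ g x + h x * d₁ h x)| + |2 * (g x * d₂ g x + h x * d₂ h x)| ≤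
            (2 + 2 * K') * (normSq g h x + η)
              - 2 * K * (d₁ g x * d₂ h x - d₂ g x * d₁ h x) := by
          rw [← h4] at h1 h3 ⊢
          nlinarith [sq_nonneg (d₁ g x), sq_nonneg (d₂ h x)]
        calc _ ≤ ψ (normSq g h x) * _ := mul_le_mul_of_nonneg_left h5 (hψ _)
          _ = _ := by ring
    _ = _ := by
        rw [integral_sub (i2.const_mul _) (i1.const_mul _), integral_const_mul,
          integral_const_mul, hJ]
        ring

/-- The bump `(t - p) (P - t)` on `[p, P]`, extended by zero. -/
noncomputable def bump (p P t : ℝ) : ℝ := max 0 ((t - p) * (P - t))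

/-- The primitive of `bump p P` vanishing at `p`. -/
noncomputable def bumpPrim (p P t : ℝ) : ℝ := ∫ r in p..t, bump p P r

lemma continuous_bump (p P : ℝ) : Continuous (bump p P) := by
  unfold bump
  fun_prop

lemma bump_nonneg (p P t : ℝ) : 0 ≤ bump p P t := le_max_left _ _

lemma bump_of_le_left {p P t : ℝ} (hpP : p ≤ P) (ht : t ≤ p) : bump p P t = 0 :=
  max_eq_left (mul_nonpos_of_nonpos_of_nonneg (by linarith) (by linarith))

lemma bump_of_right_le {p P t : ℝ} (hpP : p ≤ P) (ht : P ≤ t) : bump p P t = 0 :=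
  max_eq_left (mul_nonpos_of_nonneg_of_nonpos (by linarith) (by linarith))

lemma bump_le (p P t : ℝ) : bump p P t ≤ (P - p) ^ 2 / 4 :=
  max_le (by positivity) (by nlinarith [sq_nonneg (2 * t - p - P)])

lemma hasDerivAt_bumpPrim (p P t : ℝ) : HasDerivAt (bumpPrim p P) (bump p P t) t :=
  (continuous_bump p P).integral_hasStrictDerivAt p t |>.hasDerivAt

lemma monotone_bumpPrim (p P : ℝ) : Monotone (bumpPrim p P) :=
  monotone_of_deriv_nonneg (fun t => (hasDerivAt_bumpPrim p P t).differentiableAt)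
    fun t => by rw [(hasDerivAt_bumpPrim p P t).deriv]; exact bump_nonneg p P t

lemma bumpPrim_of_le {p P t : ℝ} (hpP : p ≤ P) (ht : t ≤ p) : bumpPrim p P t = 0 := by
  rw [bumpPrim, intervalIntegral.integral_congr (g := fun _ => 0), intervalIntegral.integral_zero]
  intro r hr
  rw [uIcc_of_ge ht] at hr
  exact bump_of_le_left hpP hr.2

lemma bumpPrim_right {p P : ℝ} (hpP : p ≤ P) : bumpPrim p P P = (P - p) ^ 3 / 6 := by
  have hd : ∀ t ∈ uIcc p P,
      HasDerivAt (fun t => (P - p) * (t - p) ^ 2 / 2 - (t - p) ^ 3 / 3) (bump p P t) t := by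
    intro t ht
    rw [uIcc_of_le hpP] at ht
    have h1 : HasDerivAt (fun t : ℝ => t - p) 1 t := (hasDerivAt_id t).sub_const p
    have := (((h1.pow 2).const_mul (P - p)).div_const 2).sub ((h1.pow 3).div_const 3)
    convert! this using 1
    rw [bump, max_eq_right (mul_nonneg (by linarith [ht.1]) (by linarith [ht.2]))]
    simp
    ring
  rw [bumpPrim, intervalIntegral.integral_eq_sub_of_hasDerivAt hd
    ((continuous_bump p P).intervalIntegrable _ _)]
  ring

lemma bumpPrim_of_ge {p P t : ℝ} (hpP : p ≤ P) (ht : P ≤ t) :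
    bumpPrim p P t = (P - p) ^ 3 / 6 := by
  have c := continuous_bump p P
  rw [← bumpPrim_right hpP, bumpPrim, bumpPrim, ← intervalIntegral.integral_add_adjacent_intervals
    (c.intervalIntegrable p P) (c.intervalIntegrable P t),
    intervalIntegral.integral_congr (a := P) (g := fun _ => 0), intervalIntegral.integral_zero,
    add_zero]
  intro r hr
  rw [uIcc_of_le ht] at hr
  exact bump_of_right_le hpP hr.1

lemma bumpPrim_le {p P : ℝ} (hpP : p ≤ P) (t : ℝ) : bumpPrim p P t ≤ (P - p) ^ 3 / 6 := by
  rw [← bumpPrim_of_ge hpP (le_max_right t P)]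
  exact monotone_bumpPrim p P (le_max_left _ _)

/-- A discrete differential inequality forcing a sequence to become small in finite time. -/
lemma lt_of_sq_add_le {q : ℕ → ℝ} {ε : ℝ} (hε : 0 < ε) (hq : ∀ k, 0 ≤ q k)
    (h : ∀ k, q (k + 1) ^ 2 + 3 * ε * q (k + 1) ≤ q k ^ 2) (N : ℕ) (hN : q 0 < N * ε) :
    q N < ε := by
  have step : ∀ k, ε ≤ q (k + 1) → q (k + 1) + ε ≤ q k := fun k hk =>
    abs_le_of_sq_le_sq' (by nlinarith [h k]) (hq k) |>.2
  have : ∀ k, ε ≤ q k → q k + k * ε ≤ q 0 := by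
    intro k
    induction k with
    | zero => simp
    | succ k ih =>
      intro hk
      have h1 := step k hk
      have h2 := ih (by linarith)
      push_cast
      linarith
  by_contra! hc
  linarith [this N hc, hq N]

/-- Truncation estimates at all low levels exclude zeros. -/
lemma pos_of_truncation_estimates {s : ℝ × ℝ → ℝ} (cs : Continuous s) {C s₀ : ℝ} (hC : 0 < C)
    (hs₀ : 0 < s₀)
    (H : ∀ p P : ℝ, 0 < p → p < P → P ≤ s₀ →
      ∫ x in cell, ((P - p) ^ 3 / 6 - bumpPrim p P (s x)) ^ 2 ≤
        C ^ 2 * (∫ x in cell, bump p P (s x) * s x) ^ 2) :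
    ∀ x ∈ cell, 0 < s x := by
  set μ : Measure (ℝ × ℝ) := volume.restrict cell with hμ
  set m : ℝ → ℝ := fun t => μ.real {x | s x ≤ t}
  have hm0 : ∀ t, 0 ≤ m t := fun t => measureReal_nonneg
  have hm1 : ∀ t, m t ≤ 1 := fun t => measureReal_le_one
  have hmeas : ∀ t, MeasurableSet {x | s x ≤ t} := fun t =>
    (isClosed_le cs continuous_const).measurableSet
  have mono : Monotone m := fun t t' h => measureReal_mono fun x hx => le_trans hx h
  have level : ∀ p P : ℝ, 0 < p → p < P → P ≤ s₀ →
      (P - p) * √(m p) ≤ 2 * C * P * (m P - m p) := by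
    intro p P hp hpP hP
    have cb : Continuous fun x => bump p P (s x) := (continuous_bump p P).comp cs
    have cB : Continuous fun x => bumpPrim p P (s x) :=
      (continuous_iff_continuousAt.2 fun t =>
        (hasDerivAt_bumpPrim p P t).continuousAt).comp cs
    have h1 : ((P - p) ^ 3 / 6) ^ 2 * m p ≤
        ∫ x in cell, ((P - p) ^ 3 / 6 - bumpPrim p P (s x)) ^ 2 := by
      have : ∫ x, {x | s x ≤ p}.indicator (fun _ => ((P - p) ^ 3 / 6) ^ 2) x ∂μ
          = ((P - p) ^ 3 / 6) ^ 2 * m p := by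
        rw [integral_indicator_const _ (hmeas p), smul_eq_mul, mul_comm]
      rw [← this]
      refine integral_mono ((integrable_const _).indicator (hmeas p))
        (integrableOn_cell (by fun_prop)) fun x => ?_
      by_cases hx : x ∈ {x | s x ≤ p}
      · rw [indicator_of_mem hx, bumpPrim_of_le hpP.le hx, sub_zero]
      · rw [indicator_of_notMem hx]
        exact sq_nonneg _
    have h2 : ∫ x in cell, bump p P (s x) * s x ≤ (P - p) ^ 2 / 4 * P * (m P - m p) := by
      have e : m P - m p = μ.real ({x | s x ≤ P} \ {x | s x ≤ p}) := by
        have hsub : {x | s x ≤ p} ⊆ {x | s x ≤ P} := fun x hx => le_trans hx hpP.le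
        rw [measureReal_sdiff hsub (hmeas p)]
      have : ∫ x, ({x | s x ≤ P} \ {x | s x ≤ p}).indicator
          (fun _ => (P - p) ^ 2 / 4 * P) x ∂μ = (P - p) ^ 2 / 4 * P * (m P - m p) := by
        rw [integral_indicator_const _ ((hmeas P).diff (hmeas p)), smul_eq_mul, mul_comm, e]
      rw [← this]
      refine integral_mono (integrableOn_cell (by fun_prop))
        ((integrable_const _).indicator ((hmeas P).diff (hmeas p))) fun x => ?_
      by_cases hx : x ∈ {x | s x ≤ P} \ {x | s x ≤ p}
      · rw [indicator_of_mem hx]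
        exact mul_le_mul (bump_le _ _ _) hx.1 (le_of_lt (hp.trans (not_le.1 hx.2)))
          (by positivity)
      · rw [indicator_of_notMem hx]
        have : bump p P (s x) = 0 := by
          by_cases hxp : s x ≤ p
          · exact bump_of_le_left hpP.le hxp
          · exact bump_of_right_le hpP.le (le_of_not_ge fun h => hx ⟨h, hxp⟩)
        simp [this]
    have h3 : 0 ≤ ∫ x in cell, bump p P (s x) * s x := by
      refine integral_nonneg fun x => ?_
      rcases le_total (s x) 0 with h | h
      · simp [bump_of_le_left hpP.le (h.trans hp.le)]
      · exact mul_nonneg (bump_nonneg _ _ _) h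
    have hd : 0 < P - p := sub_pos.2 hpP
    have h4 : ((P - p) ^ 3 / 6 * √(m p)) ^ 2 ≤
        (C * ((P - p) ^ 2 / 4 * P * (m P - m p))) ^ 2 := by
      rw [mul_pow, Real.sq_sqrt (hm0 p), mul_pow]
      refine h1.trans ((H p P hp hpP hP).trans ?_)
      gcongr
    have hmm : 0 ≤ m P - m p := sub_nonneg.2 (mono hpP.le)
    have hP0 : 0 < P := hp.trans hpP
    have h5 := abs_le_of_sq_le_sq' h4 (by positivity) |>.2
    have h6 : (P - p) ^ 2 / 6 * ((P - p) * √(m p)) ≤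
        (P - p) ^ 2 / 6 * (3 / 2 * C * P * (m P - m p)) := by
      calc _ = (P - p) ^ 3 / 6 * √(m p) := by ring
        _ ≤ _ := h5
        _ = _ := by ring
    have h7 := le_of_mul_le_mul_left h6 (by positivity)
    have h8 : 0 ≤ C * P * (m P - m p) := by positivity
    linarith
  obtain ⟨K, hK⟩ := exists_nat_gt (12 * C)
  set t₀ := s₀ * Real.exp (-K)
  have ht₀ : 0 < t₀ := by positivity
  have small : ∀ n : ℕ, 0 < n → √(m t₀) ≤ 1 / (12 * C) * (1 / n) := by
    intro n hn
    have hn' : (1 : ℝ) ≤ n := by exact_mod_cast hn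
    set r : ℝ := 1 + 1 / n
    have hr : 1 < r := by simp only [r]; linarith [show (0 : ℝ) < 1 / n by positivity]
    have hr0 : 0 < r := by linarith
    set P : ℕ → ℝ := fun k => s₀ / r ^ k
    have hP : ∀ k, P k = r * P (k + 1) := fun k => by
      simp only [P]
      field_simp
      ring
    have hP0 : ∀ k, 0 < P k := fun k => by positivity
    have hPs : ∀ k, P k ≤ s₀ := fun k => div_le_self hs₀.le (one_le_pow₀ hr.le)
    set q : ℕ → ℝ := fun k => √(m (P k))
    have hq : ∀ k, 0 ≤ q k := fun k => Real.sqrt_nonneg _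
    have hq2 : ∀ k, q k ^ 2 = m (P k) := fun k => Real.sq_sqrt (hm0 _)
    have hlt : q (K * n) < 1 / (12 * C) * (1 / n) := by
      refine lt_of_sq_add_le (by positivity) hq (fun k => ?_) _ ?_
      · have h1 := level (P (k + 1)) (P k) (hP0 _) (by
          rw [hP k]; exact lt_mul_of_one_lt_left (hP0 _) hr) (hPs k)
        have h2 : P k - P (k + 1) = 1 / n * P (k + 1) := by rw [hP k]; simp only [r]; ring
        have h3 : P k ≤ 2 * P (k + 1) := by
          rw [hP k]
          have : r ≤ 2 := by
            have := div_le_one_of_le₀ hn' (by positivity)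
            simp only [r]
            linarith
          gcongr
        change _ * q (k + 1) ≤ _ at h1
        rw [h2, ← hq2, ← hq2] at h1
        have h4 : 0 ≤ q k ^ 2 - q (k + 1) ^ 2 := by
          rw [hq2, hq2]
          refine sub_nonneg.2 (mono ?_)
          rw [hP k]
          exact le_mul_of_one_le_left (hP0 _).le hr.le
        have h5 : P (k + 1) * (1 / n * q (k + 1)) ≤
            P (k + 1) * (4 * C * (q k ^ 2 - q (k + 1) ^ 2)) := by
          calc _ = 1 / n * P (k + 1) * q (k + 1) := by ring
            _ ≤ _ := h1
            _ ≤ 2 * C * (2 * P (k + 1)) * (q k ^ 2 - q (k + 1) ^ 2) := by gcongr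
            _ = _ := by ring
        have h6 := le_of_mul_le_mul_left h5 (hP0 _)
        have h7 : 3 * (1 / (12 * C) * (1 / n)) * q (k + 1) = (1 / n * q (k + 1)) / (4 * C) := by
          field_simp
          ring
        rw [h7]
        have h8 : (1 / n * q (k + 1)) / (4 * C) ≤ q k ^ 2 - q (k + 1) ^ 2 := by
          rw [div_le_iff₀ (by positivity)]
          linarith
        linarith
      · have h1 : q 0 ≤ 1 := Real.sqrt_le_one.2 (hm1 _)
        refine h1.trans_lt ?_
        push_cast
        rw [show (K : ℝ) * n * (1 / (12 * C) * (1 / n)) = K / (12 * C) by field_simp]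
        rwa [one_lt_div (by positivity)]
    refine le_trans (Real.sqrt_le_sqrt (mono ?_)) hlt.le
    have h1 : r ^ (K * n) ≤ Real.exp K := by
      calc r ^ (K * n) ≤ Real.exp (1 / n) ^ (K * n) := by
            gcongr
            simp only [r]
            linarith [Real.add_one_le_exp ((1 : ℝ) / n)]
        _ = Real.exp K := by
            rw [← Real.exp_nat_mul]
            congr 1
            push_cast
            field_simp
    simp only [t₀, P, Real.exp_neg, ← div_eq_mul_inv]
    gcongr
  have hzero : m t₀ = 0 := by
    have hlim : Filter.Tendsto (fun n : ℕ => 1 / (12 * C) * (1 / (n : ℝ))) Filter.atTop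
        (nhds (1 / (12 * C) * 0)) := tendsto_one_div_atTop_nhds_zero_nat.const_mul _
    have h1 := ge_of_tendsto hlim (Filter.eventually_atTop.2 ⟨1, fun n hn => small n hn⟩)
    rw [mul_zero] at h1
    exact (Real.sqrt_eq_zero (hm0 _)).1 (le_antisymm h1 (Real.sqrt_nonneg _))
  intro x hx
  by_contra! hsx
  have hU : IsOpen {y | s y < t₀} := isOpen_lt cs continuous_const
  have hV : IsOpen (Ioo (0 : ℝ) 1 ×ˢ Ioo (0 : ℝ) 1) := isOpen_Ioo.prod isOpen_Ioo
  have hcl : x ∈ closure (Ioo (0 : ℝ) 1 ×ˢ Ioo (0 : ℝ) 1) := by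
    rw [closure_prod_eq, closure_Ioo zero_ne_one, ← cell_eq_prod]
    exact hx
  obtain ⟨y, hy⟩ := mem_closure_iff.1 hcl _ hU (hsx.trans_lt ht₀)
  have hpos : 0 < volume ({y | s y < t₀} ∩ Ioo (0 : ℝ) 1 ×ˢ Ioo (0 : ℝ) 1) :=
    (hU.inter hV).measure_pos _ ⟨y, hy⟩
  have hz : volume ({y | s y ≤ t₀} ∩ cell) = 0 := by
    rw [← Measure.restrict_apply (hmeas t₀)]
    exact (measureReal_eq_zero_iff).1 hzero
  refine hpos.ne' (measure_mono_null ?_ hz)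
  rw [cell_eq_prod]
  exact inter_subset_inter (fun y (hy : s y < t₀) => hy.le)
    (prod_mono Ioo_subset_Icc_self Ioo_subset_Icc_self)

lemma UnitPeriodic.sub_floor {α : Type*} {f : ℝ × ℝ → α} (hf : UnitPeriodic f) (x z : ℝ × ℝ) :
    f (z - ((⌊x.1⌋ : ℝ), (⌊x.2⌋ : ℝ))) = f z := by
  have h1 : Function.Periodic f (1, 0) := hf.1
  have h2 : Function.Periodic f (0, 1) := hf.2
  have h := (h1.zsmul ⌊x.1⌋).sub_eq (z - ⌊x.2⌋ • ((0 : ℝ), (1 : ℝ)))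
  rw [(h2.zsmul ⌊x.2⌋).sub_eq z] at h
  rw [← h]
  congr 1
  ext <;> simp

lemma sub_floor_mem_cell (x : ℝ × ℝ) : x - ((⌊x.1⌋ : ℝ), (⌊x.2⌋ : ℝ)) ∈ cell := by
  rw [cell_eq_prod]
  refine ⟨⟨?_, ?_⟩, ?_, ?_⟩
  · simp
  · simpa using (Int.sub_floor_div_mul_lt x.1 one_pos).le
  · simp
  · simpa using (Int.sub_floor_div_mul_lt x.2 one_pos).le

lemma UnitPeriodic.forall_of_cell {α : Type*} {f : ℝ × ℝ → α} (hf : UnitPeriodic f)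
    {Q : α → Prop} (h : ∀ x ∈ cell, Q (f x)) (x : ℝ × ℝ) : Q (f x) := by
  rw [← hf.sub_floor x x]
  exact h _ (sub_floor_mem_cell x)

lemma UnitPeriodic.exists_norm_le {F : Type*} [NormedAddCommGroup F] {f : ℝ × ℝ → F}
    (hf : UnitPeriodic f) (cf : Continuous f) : ∃ B, 0 ≤ B ∧ ∀ x, ‖f x‖ ≤ B := by
  obtain ⟨B, hB⟩ := isCompact_cell.exists_bound_of_continuousOn cf.continuousOn
  have : ∀ x, ‖f x‖ ≤ B := hf.forall_of_cell (Q := fun y => ‖y‖ ≤ B) hB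
  exact ⟨B, (norm_nonneg _).trans (this 0), this⟩

lemma UnitPeriodic.exists_pos_le {f : ℝ × ℝ → ℝ} (hf : UnitPeriodic f) (cf : Continuous f)
    (h0 : ∀ x, 0 < f x) : ∃ d, 0 < d ∧ ∀ x, d ≤ f x := by
  obtain ⟨x, -, hx⟩ := isCompact_cell.exists_isMinOn ⟨(0, 0), by simp [cell]⟩ cf.continuousOn
  exact ⟨f x, h0 x, hf.forall_of_cell (Q := fun y => f x ≤ y) fun y hy => hx hy⟩

lemma UnitPeriodic.exists_modulus {f : ℝ × ℝ → ℝ} (hf : UnitPeriodic f) (cf : Continuous f)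
    {ω : ℝ} (hω : 0 < ω) : ∃ δ, 0 < δ ∧ ∀ x y, ‖x - y‖ ≤ δ → |f y - f x| ≤ ω := by
  have hc : IsCompact (Icc ((-1 : ℝ), (-1 : ℝ)) (2, 2)) := isCompact_Icc
  obtain ⟨δ, hδ, H⟩ := Metric.uniformContinuousOn_iff.1
    (hc.uniformContinuousOn_of_continuous cf.continuousOn) ω hω
  refine ⟨min (δ / 2) 1, by positivity, fun x y hxy => ?_⟩
  have hx := sub_floor_mem_cell x
  set k : ℝ × ℝ := ((⌊x.1⌋ : ℝ), (⌊x.2⌋ : ℝ)) with hk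
  have h1 : ‖x - y‖ ≤ 1 := hxy.trans (min_le_right _ _)
  have h2 : ‖x - y‖ < δ := by linarith [hxy.trans (min_le_left _ _)]
  rw [Prod.norm_def, max_le_iff] at h1
  simp only [Prod.fst_sub, Prod.snd_sub, Real.norm_eq_abs, abs_le] at h1
  have hx1 : 0 ≤ x.1 - k.1 ∧ 0 ≤ x.2 - k.2 := ⟨hx.1.1, hx.1.2⟩
  have hx2 : x.1 - k.1 ≤ 1 ∧ x.2 - k.2 ≤ 1 := ⟨hx.2.1, hx.2.2⟩
  have := H (y - k)
    ⟨⟨by simp only [Prod.fst_sub]; linarith, by simp only [Prod.snd_sub]; linarith⟩,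
      ⟨by simp only [Prod.fst_sub]; linarith, by simp only [Prod.snd_sub]; linarith⟩⟩ (x - k)
    ⟨⟨by simp only [Prod.fst_sub]; linarith, by simp only [Prod.snd_sub]; linarith⟩,
      ⟨by simp only [Prod.fst_sub]; linarith, by simp only [Prod.snd_sub]; linarith⟩⟩
    (by rwa [dist_sub_right, dist_comm, dist_eq_norm])
  rw [hk, hf.sub_floor x x, hf.sub_floor x y, Real.dist_eq] at this
  exact this.le

lemma UnitPeriodic.exists_lipschitz {f : ℝ × ℝ → ℝ} (hf : UnitPeriodic f) (cf : ContDiff ℝ 1 f) :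
    ∃ L, 0 ≤ L ∧ ∀ x y, |f x - f y| ≤ L * ‖x - y‖ := by
  obtain ⟨L, hL, h⟩ := hf.fderiv.exists_norm_le (cf.continuous_fderiv one_ne_zero)
  exact ⟨L, hL, fun x y => convex_univ.norm_image_sub_le_of_norm_fderiv_le
    (fun z _ => cf.differentiable one_ne_zero z) (fun z _ => h z) (mem_univ y) (mem_univ x)⟩

/-- A Hessian whose trace against an elliptic matrix is controlled is quasiconformal up to the
square of that trace. -/
lemma exists_sq_le_of_trace {d Λ : ℝ} (hd : 0 < d) (hΛ : 0 < Λ) : ∃ K K₁ : ℝ, 0 ≤ K₁ ∧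
    ∀ p q s a b c : ℝ, 0 < p → 0 < s → d ≤ p * s - q * q → p + s ≤ Λ →
      a ^ 2 + b ^ 2 + c ^ 2 ≤ -K * (a * c - b * b)
        + K₁ * (p * a + q * b + (q * b + s * c)) ^ 2 := by
  have hμ : 0 < d / Λ := by positivity
  refine ⟨2 * Λ / (d / Λ), Λ / (2 * (d / Λ) ^ 3), by positivity, ?_⟩
  intro p q s a b c hp hs hD hT
  have hμΛ : d / Λ * Λ = d := by field_simp
  set μ := d / Λ
  set T := p + s with hT'
  have hTp : 0 < T := by positivity
  set r := p * a + q * b + (q * b + s * c) with hr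
  have hT4 : 4 * μ ≤ T := by
    refine le_of_mul_le_mul_right ?_ hΛ
    nlinarith [sq_nonneg (p - s), sq_nonneg q]
  have key : ∀ x y : ℝ, μ * (x ^ 2 + y ^ 2) ≤ p * x ^ 2 + 2 * q * x * y + s * y ^ 2 := by
    intro x y
    refine le_of_mul_le_mul_left ?_ hTp
    have e : T * (p * x ^ 2 + 2 * q * x * y + s * y ^ 2) = (p * s - q * q) * (x ^ 2 + y ^ 2)
        + (p * x + q * y) ^ 2 + (q * x + s * y) ^ 2 := by rw [hT']; ring
    rw [e]
    have : μ * T ≤ p * s - q * q := (mul_le_mul_of_nonneg_left hT hμ.le).trans (hμΛ.le.trans hD)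
    nlinarith [sq_nonneg (p * x + q * y), sq_nonneg (q * x + s * y), sq_nonneg x, sq_nonneg y,
      mul_le_mul_of_nonneg_right this (add_nonneg (sq_nonneg x) (sq_nonneg y))]
  have e : T * (b * b - a * c) = (p * a ^ 2 + 2 * q * a * b + s * b ^ 2)
      + (p * b ^ 2 + 2 * q * b * c + s * c ^ 2) - (a + c) * r := by rw [hT', hr]; ring
  have y1 : a * r ≤ μ / 2 * a ^ 2 + r ^ 2 / (2 * μ) := by
    have : 0 ≤ (μ * a - r) ^ 2 / (2 * μ) := by positivity
    have e2 : (μ * a - r) ^ 2 / (2 * μ) = μ / 2 * a ^ 2 + r ^ 2 / (2 * μ) - a * r := by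
      field_simp
      ring
    linarith
  have y2 : c * r ≤ μ / 2 * c ^ 2 + r ^ 2 / (2 * μ) := by
    have : 0 ≤ (μ * c - r) ^ 2 / (2 * μ) := by positivity
    have e2 : (μ * c - r) ^ 2 / (2 * μ) = μ / 2 * c ^ 2 + r ^ 2 / (2 * μ) - c * r := by
      field_simp
      ring
    linarith
  set S := a ^ 2 + b ^ 2 + c ^ 2 with hS
  have hS0 : 0 ≤ S := by positivity
  have main : μ / 2 * S - r ^ 2 / μ ≤ T * (b * b - a * c) := by
    have e3 : r ^ 2 / μ = r ^ 2 / (2 * μ) + r ^ 2 / (2 * μ) := by field_simp; ring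
    rw [e, e3]
    nlinarith [key a b, key b c, mul_nonneg hμ.le (sq_nonneg b)]
  have m2 : μ / (2 * Λ) * S - r ^ 2 / (4 * μ ^ 2) ≤ b * b - a * c := by
    have h1 : (μ / 2 * S - r ^ 2 / μ) / T ≤ b * b - a * c := by
      rw [div_le_iff₀ hTp]; linarith
    have h2 : μ / (2 * Λ) * S ≤ μ / 2 * S / T := by
      rw [show μ / (2 * Λ) * S = μ / 2 * S / Λ by field_simp]
      gcongr
    have h3 : r ^ 2 / μ / T ≤ r ^ 2 / (4 * μ ^ 2) := by
      rw [show r ^ 2 / (4 * μ ^ 2) = r ^ 2 / μ / (4 * μ) by field_simp]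
      gcongr
    rw [sub_div] at h1
    linarith
  have m3 := mul_le_mul_of_nonneg_left m2 (show 0 ≤ 2 * Λ / μ by positivity)
  have e4 : 2 * Λ / μ * (μ / (2 * Λ) * S - r ^ 2 / (4 * μ ^ 2))
      = S - Λ / (2 * μ ^ 3) * r ^ 2 := by
    field_simp
    ring
  rw [e4] at m3
  linarith

/-- Convolution with a kernel on the plane. -/
noncomputable def smear (ρ g : ℝ × ℝ → ℝ) (x : ℝ × ℝ) : ℝ := ∫ t, g t * ρ (x - t)

lemma smear_eq_convolution (ρ g : ℝ × ℝ → ℝ) :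
    smear ρ g = convolution g ρ (ContinuousLinearMap.mul ℝ ℝ) volume := rfl

lemma contDiff_smear {ρ g : ℝ × ℝ → ℝ} (cρ : ContDiff ℝ (⊤ : ℕ∞) ρ) (sρ : HasCompactSupport ρ)
    (cg : Continuous g) : ContDiff ℝ (⊤ : ℕ∞) (smear ρ g) :=
  sρ.contDiff_convolution_right (ContinuousLinearMap.mul ℝ ℝ) cg.locallyIntegrable cρ

lemma fderiv_smear {ρ g : ℝ × ℝ → ℝ} (cρ : ContDiff ℝ (⊤ : ℕ∞) ρ) (sρ : HasCompactSupport ρ)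
    (cg : Continuous g) (x v : ℝ × ℝ) :
    fderiv ℝ (smear ρ g) x v = smear (fun y => fderiv ℝ ρ y v) g x := by
  have c1 : ContDiff ℝ 1 ρ := cρ.of_le (by exact_mod_cast le_top)
  rw [smear_eq_convolution, (sρ.hasFDerivAt_convolution_right _ cg.locallyIntegrable c1 x).fderiv,
    convolution_precompR_apply _ cg.locallyIntegrable (sρ.fderiv ℝ)
      (c1.continuous_fderiv one_ne_zero)]
  rfl

lemma UnitPeriodic.smear {ρ g : ℝ × ℝ → ℝ} (pg : UnitPeriodic g) : UnitPeriodic (smear ρ g) := by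
  have key : ∀ e : ℝ × ℝ, (∀ x, g (x + e) = g x) →
      ∀ x, PeriodicGradient.smear ρ g (x + e) = PeriodicGradient.smear ρ g x := by
    intro e he x
    unfold PeriodicGradient.smear
    rw [← integral_add_right_eq_self _ e]
    simp_rw [he, add_sub_add_right_eq_sub]
  exact ⟨key _ pg.1, key _ pg.2⟩

lemma hasCompactSupport_reflect {ρ : ℝ × ℝ → ℝ} (sρ : HasCompactSupport ρ) (x : ℝ × ℝ) :
    HasCompactSupport fun t => ρ (x - t) :=
  sρ.comp_homeomorph (Homeomorph.subLeft x)

lemma fderiv_reflect {ρ : ℝ × ℝ → ℝ} (dρ : Differentiable ℝ ρ) (x t v : ℝ × ℝ) :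
    fderiv ℝ (fun t => ρ (x - t)) t v = -fderiv ℝ ρ (x - t) v := by
  have h : HasFDerivAt (fun t : ℝ × ℝ => x - t) (-ContinuousLinearMap.id ℝ (ℝ × ℝ)) t :=
    (hasFDerivAt_id t).const_sub x
  have h2 : HasFDerivAt (fun t => ρ (x - t))
      ((fderiv ℝ ρ (x - t)).comp (-ContinuousLinearMap.id ℝ (ℝ × ℝ))) t :=
    (dρ (x - t)).hasFDerivAt.comp t h
  rw [h2.fderiv]
  simp

lemma integrable_mul_reflect {ρ g : ℝ × ℝ → ℝ} (cρ : Continuous ρ) (sρ : HasCompactSupport ρ)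
    (cg : Continuous g) (x : ℝ × ℝ) : Integrable fun t => g t * ρ (x - t) :=
  Continuous.integrable_of_hasCompactSupport (by fun_prop)
    (hasCompactSupport_reflect sρ x).mul_left

/-- Approximate identities with the expected scaling of the derivative. -/
lemma exists_mollifier : ∃ N : ℝ, 0 ≤ N ∧ ∀ δ : ℝ, 0 < δ → ∃ ρ : ℝ × ℝ → ℝ,
    ContDiff ℝ (⊤ : ℕ∞) ρ ∧ HasCompactSupport ρ ∧ (∀ y, 0 ≤ ρ y) ∧ ∫ y, ρ y = 1 ∧
    (∀ y, δ < ‖y‖ → ρ y = 0) ∧ (∀ y, δ < ‖y‖ → fderiv ℝ ρ y = 0) ∧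
    ∀ y, ‖fderiv ℝ ρ y‖ ≤ N / δ ^ 3 := by
  let f : ContDiffBump (0 : ℝ × ℝ) := ⟨1 / 2, 1, by norm_num, by norm_num⟩
  set ρ₀ := f.normed volume
  have c₀ : ContDiff ℝ (⊤ : ℕ∞) ρ₀ := f.contDiff_normed
  have s₀ : HasCompactSupport ρ₀ := f.hasCompactSupport_normed
  obtain ⟨N, hN⟩ := (s₀.fderiv ℝ).exists_bound_of_continuous
    (c₀.continuous_fderiv (by simp))
  refine ⟨N, (norm_nonneg _).trans (hN 0), fun δ hδ => ?_⟩
  have hz : ∀ y : ℝ × ℝ, δ < ‖y‖ → (δ ^ 2)⁻¹ * ρ₀ (δ⁻¹ • y) = 0 := by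
    intro y hy
    have : δ⁻¹ • y ∉ Function.support ρ₀ := by
      rw [f.support_normed_eq, mem_ball_zero_iff, norm_smul, Real.norm_of_nonneg (by positivity),
        not_lt]
      change 1 ≤ δ⁻¹ * ‖y‖
      rw [inv_mul_eq_div, one_le_div hδ]
      exact hy.le
    rw [Function.notMem_support.1 this, mul_zero]
  have hd : ∀ y, HasFDerivAt (fun y => (δ ^ 2)⁻¹ * ρ₀ (δ⁻¹ • y))
      ((δ ^ 2)⁻¹ • (fderiv ℝ ρ₀ (δ⁻¹ • y)).comp
        (δ⁻¹ • ContinuousLinearMap.id ℝ (ℝ × ℝ))) y := fun y => by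
    have h1 : HasFDerivAt (fun y : ℝ × ℝ => δ⁻¹ • y) (δ⁻¹ • ContinuousLinearMap.id ℝ (ℝ × ℝ)) y :=
      (hasFDerivAt_id y).const_smul δ⁻¹
    exact (((c₀.differentiable (by simp)) _).hasFDerivAt.comp y h1).const_mul _
  refine ⟨fun y => (δ ^ 2)⁻¹ * ρ₀ (δ⁻¹ • y), ?_, ?_, ?_, ?_, hz, ?_, ?_⟩
  · exact contDiff_const.mul (c₀.comp (contDiff_const_smul _))
  · exact HasCompactSupport.of_support_subset_isCompact (isCompact_closedBall (0 : ℝ × ℝ) δ)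
      fun y hy => by
        rw [mem_closedBall_zero_iff]
        by_contra! h
        exact hy (hz y h)
  · exact fun y => mul_nonneg (by positivity) (f.nonneg_normed _)
  · rw [integral_const_mul, Measure.integral_comp_inv_smul]
    have : ∫ x, ρ₀ x = 1 := f.integral_normed
    rw [this]
    simp [hδ.ne']
  · intro y hy
    have : (fun y => (δ ^ 2)⁻¹ * ρ₀ (δ⁻¹ • y)) =ᶠ[nhds y] fun _ => 0 := by
      filter_upwards [(isOpen_lt continuous_const continuous_norm).mem_nhds hy] with z hz'
      exact hz z hz'
    rw [this.fderiv_eq]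
    simp
  · intro y
    rw [(hd y).fderiv, norm_smul, Real.norm_of_nonneg (by positivity)]
    calc (δ ^ 2)⁻¹ * _ ≤ (δ ^ 2)⁻¹ * (N * (δ⁻¹ * 1)) := by
          refine mul_le_mul_of_nonneg_left ?_ (by positivity)
          refine (ContinuousLinearMap.opNorm_comp_le _ _).trans ?_
          refine mul_le_mul (hN _) ?_ (norm_nonneg _) ((norm_nonneg _).trans (hN 0))
          rw [norm_smul, Real.norm_of_nonneg (by positivity)]
          exact mul_le_mul_of_nonneg_left ContinuousLinearMap.norm_id_le (by positivity)
      _ = N / δ ^ 3 := by field_simp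

lemma abs_smear_sub_le {ρ g : ℝ × ℝ → ℝ} (cρ : Continuous ρ) (sρ : HasCompactSupport ρ)
    (hρ : ∀ y, 0 ≤ ρ y) (h1 : ∫ y, ρ y = 1) {δ ω : ℝ} (hz : ∀ y, δ < ‖y‖ → ρ y = 0)
    (cg : Continuous g) (x : ℝ × ℝ) (hω : ∀ t, ‖x - t‖ ≤ δ → |g t - g x| ≤ ω) :
    |smear ρ g x - g x| ≤ ω := by
  have h1x : ∫ t, ρ (x - t) = 1 := by rw [integral_sub_left_eq_self, h1]
  have i1 := integrable_mul_reflect cρ sρ cg x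
  have i2 : ∀ c : ℝ, Integrable fun t => c * ρ (x - t) := fun c =>
    integrable_mul_reflect cρ sρ continuous_const x
  have e : smear ρ g x - g x = ∫ t, (g t - g x) * ρ (x - t) := by
    simp_rw [sub_mul]
    rw [integral_sub i1 (i2 _), integral_const_mul, h1x, mul_one]
    rfl
  have e2 : ω = ∫ t, ω * ρ (x - t) := by rw [integral_const_mul, h1x, mul_one]
  rw [e, e2, ← Real.norm_eq_abs]
  refine norm_integral_le_of_norm_le (i2 ω) (ae_of_all _ fun t => ?_)
  rw [norm_mul, Real.norm_eq_abs, Real.norm_of_nonneg (hρ _)]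
  by_cases h : ‖x - t‖ ≤ δ
  · exact mul_le_mul_of_nonneg_right (hω t h) (hρ _)
  · rw [hz _ (not_le.1 h)]
    simp

lemma abs_integral_le_of_closedBall {F : ℝ × ℝ → ℝ} {x : ℝ × ℝ} {δ B : ℝ} (hδ : 0 < δ)
    (h0 : ∀ t, δ < ‖x - t‖ → F t = 0) (hB : ∀ t, ‖x - t‖ ≤ δ → |F t| ≤ B) :
    |∫ t, F t| ≤ B * (4 * δ ^ 2) := by
  have hm : ∀ t, t ∈ Metric.closedBall x δ ↔ ‖x - t‖ ≤ δ := fun t => by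
    rw [mem_closedBall_iff_norm, norm_sub_rev]
  have hv : volume (Metric.closedBall x δ) = ENNReal.ofReal (4 * δ ^ 2) := by
    rw [show x = (x.1, x.2) from rfl, ← closedBall_prod_same, Measure.volume_eq_prod,
      Measure.prod_prod, Real.volume_closedBall, Real.volume_closedBall,
      ← ENNReal.ofReal_mul (by positivity)]
    congr 1
    ring
  have hv' : volume.real (Metric.closedBall x δ) = 4 * δ ^ 2 := by
    rw [measureReal_def, hv, ENNReal.toReal_ofReal (by positivity)]
  rw [← setIntegral_eq_integral_of_forall_compl_eq_zero (s := Metric.closedBall x δ)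
    fun t ht => h0 t (not_le.1 fun h => ht ((hm t).2 h)), ← hv', ← Real.norm_eq_abs]
  exact norm_setIntegral_le_of_norm_le_const (by rw [hv]; exact ENNReal.ofReal_lt_top)
    fun t ht => hB t ((hm t).1 ht)

/-- The commutator estimate: the trace of the mollified Hessian is of lower order. -/
lemma smear_trace_bound {g h p q s ρ : ℝ × ℝ → ℝ} (cg : Continuous g) (ch : Continuous h)
    (cp : Continuous p) (cq : Continuous q) (cs : Continuous s)
    {L N δ A B : ℝ} (hL : 0 ≤ L) (hN : 0 ≤ N) (hδ : 0 < δ) (hA : 0 ≤ A) (hB : 0 ≤ B)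
    (Lp : ∀ x y, |p x - p y| ≤ L * ‖x - y‖) (Lq : ∀ x y, |q x - q y| ≤ L * ‖x - y‖)
    (Ls : ∀ x y, |s x - s y| ≤ L * ‖x - y‖)
    (hdiv : ∀ φ : ℝ × ℝ → ℝ, ContDiff ℝ (⊤ : ℕ∞) φ → HasCompactSupport φ →
      ∫ t, ((p t * g t + q t * h t) * d₁ φ t + (q t * g t + s t * h t) * d₂ φ t) = 0)
    (cρ : ContDiff ℝ (⊤ : ℕ∞) ρ) (sρ : HasCompactSupport ρ)
    (hz : ∀ y, δ < ‖y‖ → fderiv ℝ ρ y = 0) (hNρ : ∀ y, ‖fderiv ℝ ρ y‖ ≤ N / δ ^ 3)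
    (x : ℝ × ℝ) (hgA : ∀ t, ‖x - t‖ ≤ δ → |g t| ≤ A) (hhB : ∀ t, ‖x - t‖ ≤ δ → |h t| ≤ B) :
    |p x * d₁ (smear ρ g) x + q x * d₂ (smear ρ g) x +
      (q x * d₁ (smear ρ h) x + s x * d₂ (smear ρ h) x)| ≤ 8 * L * N * (A + B) := by
  have dρ : Differentiable ℝ ρ := cρ.differentiable (by simp)
  have c1 : Continuous (d₁ ρ) := continuous_d₁ (cρ.of_le (by exact_mod_cast le_top))
  have c2 : Continuous (d₂ ρ) := continuous_d₂ (cρ.of_le (by exact_mod_cast le_top))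
  have s1 : HasCompactSupport (d₁ ρ) := sρ.fderiv_apply ℝ (1, 0)
  have s2 : HasCompactSupport (d₂ ρ) := sρ.fderiv_apply ℝ (0, 1)
  have I : ∀ (f : ℝ × ℝ → ℝ), Continuous f → (Integrable fun t => f t * d₁ ρ (x - t)) ∧
      Integrable fun t => f t * d₂ ρ (x - t) := fun f cf =>
    ⟨integrable_mul_reflect c1 s1 cf x, integrable_mul_reflect c2 s2 cf x⟩
  have e1 : d₁ (smear ρ g) x = ∫ t, g t * d₁ ρ (x - t) := fderiv_smear cρ sρ cg x _
  have e2 : d₂ (smear ρ g) x = ∫ t, g t * d₂ ρ (x - t) := fderiv_smear cρ sρ cg x _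
  have e3 : d₁ (smear ρ h) x = ∫ t, h t * d₁ ρ (x - t) := fderiv_smear cρ sρ ch x _
  have e4 : d₂ (smear ρ h) x = ∫ t, h t * d₂ ρ (x - t) := fderiv_smear cρ sρ ch x _
  have D := hdiv (fun t => ρ (x - t)) (cρ.comp (contDiff_const.sub contDiff_id))
    (hasCompactSupport_reflect sρ x)
  have D' : ∫ t, ((p t * g t + q t * h t) * d₁ ρ (x - t) +
      (q t * g t + s t * h t) * d₂ ρ (x - t)) = 0 := by
    rw [← neg_eq_zero, ← integral_neg, ← D]
    congr 1
    ext t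
    have r1 : d₁ (fun t => ρ (x - t)) t = -d₁ ρ (x - t) := fderiv_reflect dρ x t _
    have r2 : d₂ (fun t => ρ (x - t)) t = -d₂ ρ (x - t) := fderiv_reflect dρ x t _
    rw [r1, r2]
    ring
  have ID : Integrable fun t => (p t * g t + q t * h t) * d₁ ρ (x - t) +
      (q t * g t + s t * h t) * d₂ ρ (x - t) :=
    (I _ (by fun_prop)).1.add (I _ (by fun_prop)).2
  have Ig : Integrable fun t => p x * (g t * d₁ ρ (x - t)) + q x * (g t * d₂ ρ (x - t)) :=
    ((I g cg).1.const_mul _).add ((I g cg).2.const_mul _)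
  have Ih : Integrable fun t => q x * (h t * d₁ ρ (x - t)) + s x * (h t * d₂ ρ (x - t)) :=
    ((I h ch).1.const_mul _).add ((I h ch).2.const_mul _)
  have Igh : Integrable fun t => p x * (g t * d₁ ρ (x - t)) + q x * (g t * d₂ ρ (x - t)) +
      (q x * (h t * d₁ ρ (x - t)) + s x * (h t * d₂ ρ (x - t))) := Ig.add Ih
  have e : p x * d₁ (smear ρ g) x + q x * d₂ (smear ρ g) x +
      (q x * d₁ (smear ρ h) x + s x * d₂ (smear ρ h) x) =
      ∫ t, (((p x - p t) * g t + (q x - q t) * h t) * d₁ ρ (x - t) +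
        ((q x - q t) * g t + (s x - s t) * h t) * d₂ ρ (x - t)) := by
    rw [e1, e2, e3, e4, ← integral_const_mul, ← integral_const_mul, ← integral_const_mul,
      ← integral_const_mul, ← integral_add ((I g cg).1.const_mul _) ((I g cg).2.const_mul _),
      ← integral_add ((I h ch).1.const_mul _) ((I h ch).2.const_mul _), ← integral_add Ig Ih,
      ← sub_zero (∫ t, _), ← D', ← integral_sub Igh ID]
    congr 1
    ext t
    ring
  rw [e]
  have hb : ∀ y v : ℝ × ℝ, ‖v‖ ≤ 1 → |fderiv ℝ ρ y v| ≤ N / δ ^ 3 := fun y v hv =>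
    ((fderiv ℝ ρ y).unit_le_opNorm v hv).trans (hNρ y)
  have hcomb : ∀ α β t, |α| ≤ L * δ → |β| ≤ L * δ → ‖x - t‖ ≤ δ →
      |α * g t + β * h t| ≤ L * δ * (A + B) := by
    intro α β t hα hβ ht
    calc _ ≤ |α| * |g t| + |β| * |h t| := by
          rw [← abs_mul, ← abs_mul]
          exact abs_add_le _ _
      _ ≤ L * δ * A + L * δ * B := by
          gcongr
          · exact hgA t ht
          · exact hhB t ht
      _ = _ := by ring
  have e5 : 8 * L * N * (A + B) =
      (L * δ * (A + B) * (N / δ ^ 3) + L * δ * (A + B) * (N / δ ^ 3)) * (4 * δ ^ 2) := by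
    field_simp
    ring
  rw [e5]
  refine abs_integral_le_of_closedBall (x := x) hδ ?_ ?_
  · intro t ht
    simp [d₁, d₂, hz _ ht]
  · intro t ht
    have l : ∀ f : ℝ × ℝ → ℝ, (∀ x y, |f x - f y| ≤ L * ‖x - y‖) → |f x - f t| ≤ L * δ :=
      fun f hf => (hf x t).trans (by gcongr)
    refine (abs_add_le _ _).trans ?_
    rw [abs_mul, abs_mul]
    have h1 : |d₁ ρ (x - t)| ≤ N / δ ^ 3 := hb _ _ (by simp [Prod.norm_def])
    have h2 : |d₂ ρ (x - t)| ≤ N / δ ^ 3 := hb _ _ (by simp [Prod.norm_def])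
    have h3 := hcomb _ _ t (l p Lp) (l q Lq) ht
    have h4 := hcomb _ _ t (l q Lq) (l s Ls) ht
    gcongr

/-- Smooth periodic approximations of a periodic weak solution. -/
lemma exists_approximation {g h p q s : ℝ × ℝ → ℝ} (cg : Continuous g) (ch : Continuous h)
    (pg : UnitPeriodic g) (ph : UnitPeriodic h)
    (cp : ContDiff ℝ 1 p) (cq : ContDiff ℝ 1 q) (cs : ContDiff ℝ 1 s)
    (pp : UnitPeriodic p) (pq : UnitPeriodic q) (ps : UnitPeriodic s)
    (hcurl : ∀ φ : ℝ × ℝ → ℝ, ContDiff ℝ (⊤ : ℕ∞) φ → HasCompactSupport φ →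
      ∫ t, g t * d₂ φ t = ∫ t, h t * d₁ φ t)
    (hdiv : ∀ φ : ℝ × ℝ → ℝ, ContDiff ℝ (⊤ : ℕ∞) φ → HasCompactSupport φ →
      ∫ t, ((p t * g t + q t * h t) * d₁ φ t + (q t * g t + s t * h t) * d₂ φ t) = 0) :
    ∃ R : ℝ, 0 ≤ R ∧ ∀ ω : ℝ, 0 < ω → ∃ g' h' : ℝ × ℝ → ℝ, ContDiff ℝ 2 g' ∧ ContDiff ℝ 2 h' ∧
      UnitPeriodic g' ∧ UnitPeriodic h' ∧ (∀ x, d₂ g' x = d₁ h' x) ∧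
      (∀ x, |g' x - g x| ≤ ω) ∧ (∀ x, |h' x - h x| ≤ ω) ∧
      ∀ x, (p x * d₁ g' x + q x * d₂ g' x + (q x * d₂ g' x + s x * d₂ h' x)) ^ 2 ≤
        R * (normSq g' h' x + 16 * ω ^ 2) := by
  obtain ⟨L₁, hL₁, Lp⟩ := pp.exists_lipschitz cp
  obtain ⟨L₂, hL₂, Lq⟩ := pq.exists_lipschitz cq
  obtain ⟨L₃, hL₃, Ls⟩ := ps.exists_lipschitz cs
  obtain ⟨N, hN, hmol⟩ := exists_mollifier
  set L := L₁ + L₂ + L₃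
  have hL : 0 ≤ L := by positivity
  refine ⟨(8 * L * N) ^ 2 * 3, by positivity, fun ω hω => ?_⟩
  obtain ⟨δ₁, hδ₁, hg⟩ := pg.exists_modulus cg hω
  obtain ⟨δ₂, hδ₂, hh⟩ := ph.exists_modulus ch hω
  obtain ⟨ρ, cρ, sρ, hρ, ρ1, hz, hz', hNρ⟩ := hmol (min δ₁ δ₂) (by positivity)
  have dρ : Differentiable ℝ ρ := cρ.differentiable (by simp)
  set δ := min δ₁ δ₂
  have hg' : ∀ x t, ‖x - t‖ ≤ δ → |g t - g x| ≤ ω := fun x t ht =>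
    hg x t (ht.trans (min_le_left _ _))
  have hh' : ∀ x t, ‖x - t‖ ≤ δ → |h t - h x| ≤ ω := fun x t ht =>
    hh x t (ht.trans (min_le_right _ _))
  have ag : ∀ x, |smear ρ g x - g x| ≤ ω := fun x =>
    abs_smear_sub_le cρ.continuous sρ hρ ρ1 hz cg x (hg' x)
  have ah : ∀ x, |smear ρ h x - h x| ≤ ω := fun x =>
    abs_smear_sub_le cρ.continuous sρ hρ ρ1 hz ch x (hh' x)
  have curl : ∀ x, d₂ (smear ρ g) x = d₁ (smear ρ h) x := by
    intro x
    have e1 : d₂ (smear ρ g) x = ∫ t, g t * d₂ ρ (x - t) := fderiv_smear cρ sρ cg x _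
    have e2 : d₁ (smear ρ h) x = ∫ t, h t * d₁ ρ (x - t) := fderiv_smear cρ sρ ch x _
    have D := hcurl (fun t => ρ (x - t)) (cρ.comp (contDiff_const.sub contDiff_id))
      (hasCompactSupport_reflect sρ x)
    have r1 : ∀ t, d₁ (fun t => ρ (x - t)) t = -d₁ ρ (x - t) := fun t => fderiv_reflect dρ x t _
    have r2 : ∀ t, d₂ (fun t => ρ (x - t)) t = -d₂ ρ (x - t) := fun t => fderiv_reflect dρ x t _
    simp_rw [r1, r2, mul_neg, integral_neg] at D
    rw [e1, e2]
    linarith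
  refine ⟨smear ρ g, smear ρ h, contDiff_infty.1 (contDiff_smear cρ sρ cg) 2,
    contDiff_infty.1 (contDiff_smear cρ sρ ch) 2, pg.smear, ph.smear, curl, ag, ah,
    fun x => ?_⟩
  have bd : ∀ f : ℝ × ℝ → ℝ, |smear ρ f x - f x| ≤ ω →
      (∀ t, ‖x - t‖ ≤ δ → |f t - f x| ≤ ω) →
      ∀ t, ‖x - t‖ ≤ δ → |f t| ≤ |smear ρ f x| + 2 * ω := by
    intro f h1 h2 t ht
    have h3 := h2 t ht
    have h4 : f t = (f t - f x) - (smear ρ f x - f x) + smear ρ f x := by ring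
    rw [h4]
    refine (abs_add_le _ _).trans ?_
    linarith [abs_sub (f t - f x) (smear ρ f x - f x)]
  have mono : ∀ (f : ℝ × ℝ → ℝ) (M : ℝ), M ≤ L → (∀ x y, |f x - f y| ≤ M * ‖x - y‖) →
      ∀ x y, |f x - f y| ≤ L * ‖x - y‖ := fun f M hM hf x y =>
    (hf x y).trans (by gcongr)
  have T := smear_trace_bound cg ch cp.continuous cq.continuous cs.continuous hL hN
    (by positivity : 0 < δ) (by positivity) (by positivity)
    (mono p L₁ (by simp only [L]; linarith) Lp) (mono q L₂ (by simp only [L]; linarith) Lq)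
    (mono s L₃ (by simp only [L]; linarith) Ls) hdiv cρ sρ hz' hNρ x
    (bd g (ag x) (hg' x)) (bd h (ah x) (hh' x))
  rw [← curl x] at T
  have T2 := pow_le_pow_left₀ (abs_nonneg _) T 2
  rw [sq_abs, mul_pow] at T2
  refine T2.trans ?_
  rw [mul_assoc (_ ^ 2)]
  refine mul_le_mul_of_nonneg_left ?_ (by positivity)
  unfold normSq
  nlinarith [sq_nonneg (|smear ρ g x| - |smear ρ h x|), sq_nonneg (|smear ρ g x| - 4 * ω),
    sq_nonneg (|smear ρ h x| - 4 * ω), sq_abs (smear ρ g x), sq_abs (smear ρ h x)]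

lemma UnitPeriodic.exists_square {f : ℝ × ℝ → ℝ} (hf : UnitPeriodic f) (cf : Continuous f)
    {x₀ : ℝ × ℝ} (h0 : 0 < f x₀) : ∃ s₀ a b l : ℝ, 0 < s₀ ∧ 0 ≤ a ∧ 0 ≤ b ∧ 0 < l ∧
      a + l ≤ 1 ∧ b + l ≤ 1 ∧
      ∀ x ∈ Icc a (a + l), ∀ y ∈ Icc b (b + l), 2 * s₀ ≤ f (x, y) := by
  have hU : IsOpen {y | f x₀ / 2 < f y} := isOpen_lt continuous_const cf
  have hV : IsOpen (Ioo (0 : ℝ) 1 ×ˢ Ioo (0 : ℝ) 1) := isOpen_Ioo.prod isOpen_Ioo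
  have hcl : x₀ - ((⌊x₀.1⌋ : ℝ), (⌊x₀.2⌋ : ℝ)) ∈ closure (Ioo (0 : ℝ) 1 ×ˢ Ioo (0 : ℝ) 1) := by
    rw [closure_prod_eq, closure_Ioo zero_ne_one, ← cell_eq_prod]
    exact sub_floor_mem_cell x₀
  obtain ⟨y, hy⟩ := mem_closure_iff.1 hcl _ hU (by
    change _ < f _
    rw [hf.sub_floor x₀ x₀]
    linarith)
  obtain ⟨ε, hε, hball⟩ := Metric.isOpen_iff.1 (hU.inter hV) y hy
  have hmem : ∀ x ∈ Icc y.1 (y.1 + ε / 2), ∀ z ∈ Icc y.2 (y.2 + ε / 2),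
      (x, z) ∈ {y | f x₀ / 2 < f y} ∩ Ioo (0 : ℝ) 1 ×ˢ Ioo (0 : ℝ) 1 := by
    intro x hx z hz
    apply hball
    rw [Metric.mem_ball, Prod.dist_eq, max_lt_iff, Real.dist_eq, Real.dist_eq, abs_lt, abs_lt]
    exact ⟨⟨by linarith [hx.1], by linarith [hx.2]⟩, by linarith [hz.1], by linarith [hz.2]⟩
  have hcorner := hmem (y.1 + ε / 2) ⟨by linarith, le_rfl⟩ (y.2 + ε / 2) ⟨by linarith, le_rfl⟩
  exact ⟨f x₀ / 4, y.1, y.2, ε / 2, by positivity, hy.2.1.1.le, hy.2.2.1.le, by positivity,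
    hcorner.2.1.2.le, hcorner.2.2.2.le, fun x hx z hz => by
      have : f x₀ / 2 < f (x, z) := (hmem x hx z hz).1
      linarith⟩

lemma bumpPrim_nonneg {p P : ℝ} (hpP : p ≤ P) (t : ℝ) : 0 ≤ bumpPrim p P t := by
  rw [← bumpPrim_of_le hpP (min_le_right t p)]
  exact monotone_bumpPrim p P (min_le_left _ _)

lemma continuous_bumpPrim (p P : ℝ) : Continuous (bumpPrim p P) :=
  continuous_iff_continuousAt.2 fun t => (hasDerivAt_bumpPrim p P t).continuousAt

/-- A periodic, nontrivial, curl free field whose image under a periodic elliptic matrix is weakly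
divergence free has no zeros. -/
theorem normSq_pos_of_weak_solution {g h p q s : ℝ × ℝ → ℝ} (cg : Continuous g)
    (ch : Continuous h) (pg : UnitPeriodic g) (ph : UnitPeriodic h)
    (cp : ContDiff ℝ 1 p) (cq : ContDiff ℝ 1 q) (cs : ContDiff ℝ 1 s)
    (pp : UnitPeriodic p) (pq : UnitPeriodic q) (ps : UnitPeriodic s)
    (hp : ∀ x, 0 < p x) (hs : ∀ x, 0 < s x) (hdet : ∀ x, 0 < p x * s x - q x * q x)
    (hcurl : ∀ φ : ℝ × ℝ → ℝ, ContDiff ℝ (⊤ : ℕ∞) φ → HasCompactSupport φ →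
      ∫ t, g t * d₂ φ t = ∫ t, h t * d₁ φ t)
    (hdiv : ∀ φ : ℝ × ℝ → ℝ, ContDiff ℝ (⊤ : ℕ∞) φ → HasCompactSupport φ →
      ∫ t, ((p t * g t + q t * h t) * d₁ φ t + (q t * g t + s t * h t) * d₂ φ t) = 0)
    {x₀ : ℝ × ℝ} (h0 : 0 < normSq g h x₀) (x : ℝ × ℝ) : 0 < normSq g h x := by
  have cn : Continuous (normSq g h) := (cg.mul cg).add (ch.mul ch)
  have pn : UnitPeriodic (normSq g h) := pg.comp₂ ph fun a b => a * a + b * b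
  refine pn.forall_of_cell (Q := fun t => 0 < t) ?_ x
  obtain ⟨d, hd, hdet'⟩ := ((pp.comp₂ ps fun a b => a * b).comp₂ (pq.comp fun a => a * a)
    fun a b => a - b).exists_pos_le (by
      have := cp.continuous
      have := cq.continuous
      have := cs.continuous
      fun_prop) hdet
  obtain ⟨Λ₀, hΛ₀, hT⟩ := (pp.comp₂ ps fun a b => a + b).exists_norm_le
    (cp.continuous.add cs.continuous)
  obtain ⟨K, K₁, hK₁, hlin⟩ := exists_sq_le_of_trace hd (by positivity : 0 < Λ₀ + 1)
  obtain ⟨R, hR, happ⟩ := exists_approximation cg ch pg ph cp cq cs pp pq ps hcurl hdiv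
  obtain ⟨B₁, hB₁, hgB⟩ := pg.exists_norm_le cg
  obtain ⟨B₂, hB₂, hhB⟩ := ph.exists_norm_le ch
  obtain ⟨s₀, a, b, l, hs₀, ha, hb, hl, hal, hbl, hsq⟩ := pn.exists_square cn h0
  set ω : ℕ → ℝ := fun n => 1 / ((n : ℝ) + 1)
  have hω0 : ∀ n, 0 < ω n := fun n => by positivity
  have hω1 : ∀ n, ω n ≤ 1 := fun n => by
    simp only [ω]
    rw [div_le_one (by positivity)]
    linarith [(Nat.cast_nonneg n : (0 : ℝ) ≤ n)]
  have hωt : Filter.Tendsto ω Filter.atTop (nhds 0) := tendsto_one_div_add_atTop_nhds_zero_nat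
  choose G H cG cH pG pH curl hG hH htr using fun n => happ (ω n) (hω0 n)
  set E : ℝ := 2 * B₁ + 1 + (2 * B₂ + 1)
  have hE : 0 ≤ E := by positivity
  have close : ∀ n x, |normSq (G n) (H n) x - normSq g h x| ≤ ω n * E := by
    intro n x
    have key : ∀ (u v B : ℝ), ‖v‖ ≤ B → |u - v| ≤ ω n → |u * u - v * v| ≤ ω n * (2 * B + 1) := by
      intro u v B hv huv
      have e : u * u - v * v = (u - v) * (u - v + 2 * v) := by ring
      rw [e, abs_mul]
      refine mul_le_mul huv ?_ (abs_nonneg _) (hω0 n).le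
      refine (abs_add_le _ _).trans ?_
      rw [abs_mul, abs_two]
      rw [Real.norm_eq_abs] at hv
      linarith [hω1 n]
    have e : normSq (G n) (H n) x - normSq g h x =
        (G n x * G n x - g x * g x) + (H n x * H n x - h x * h x) := by
      unfold normSq
      ring
    rw [e]
    refine (abs_add_le _ _).trans ?_
    simp only [E]
    rw [mul_add]
    exact add_le_add (key _ _ _ (hgB x) (hG n x)) (key _ _ _ (hhB x) (hH n x))
  have lim : ∀ x, Filter.Tendsto (fun n => normSq (G n) (H n) x) Filter.atTop
      (nhds (normSq g h x)) := by
    intro x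
    rw [tendsto_iff_norm_sub_tendsto_zero]
    refine squeeze_zero (fun n => norm_nonneg _) (fun n => close n x) ?_
    simpa using hωt.mul_const E
  set C := (1 + 1 / l) * (2 + 2 * (K₁ * R))
  have hC : 0 < C := by positivity
  refine pos_of_truncation_estimates cn hC hs₀ fun α β hα hαβ hβ => ?_
  have est : ∀ᶠ n in Filter.atTop,
      ∫ x in cell, ((β - α) ^ 3 / 6 - bumpPrim α β (normSq (G n) (H n) x)) ^ 2 ≤
        C ^ 2 * (∫ x in cell, bump α β (normSq (G n) (H n) x) *
          (normSq (G n) (H n) x + 16 * ω n ^ 2)) ^ 2 := by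
    have hev : ∀ᶠ n in Filter.atTop, ω n * E < s₀ := by
      have := hωt.mul_const E
      rw [zero_mul] at this
      exact this.eventually_lt_const hs₀
    filter_upwards [hev] with n hn
    refine setIntegral_cell_truncation_sq_le (cG n) (cH n) (pG n) (pH n) (curl n) (K := K)
      (fun x => ?_) (by positivity) (continuous_bump α β) (bump_nonneg α β)
      (hasDerivAt_bumpPrim α β) hα (fun t => bumpPrim_of_le hαβ.le)
      (fun t => bumpPrim_of_ge hαβ.le) (bumpPrim_le hαβ.le) ha hb hl hal hbl
      fun x hx y hy => ?_
    · have h1 := hlin (p x) (q x) (s x) (d₁ (G n) x) (d₂ (G n) x) (d₂ (H n) x) (hp x) (hs x)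
        (hdet' x) (((le_abs_self _).trans (hT x)).trans (by linarith))
      rw [← curl n x]
      refine h1.trans (add_le_add le_rfl ?_)
      rw [mul_assoc]
      exact mul_le_mul_of_nonneg_left (htr n x) hK₁
    · have h1 := hsq x hx y hy
      have h2 := (abs_le.1 (close n (x, y))).1
      linarith
  have cN : ∀ n, Continuous (normSq (G n) (H n)) := fun n =>
    (contDiff_normSq (cG n) (cH n)).continuous
  have lim1 : Filter.Tendsto
      (fun n => ∫ x in cell, ((β - α) ^ 3 / 6 - bumpPrim α β (normSq (G n) (H n) x)) ^ 2)
      Filter.atTop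
      (nhds (∫ x in cell, ((β - α) ^ 3 / 6 - bumpPrim α β (normSq g h x)) ^ 2)) := by
    refine tendsto_integral_of_dominated_convergence (fun _ => ((β - α) ^ 3 / 6) ^ 2)
      (fun n => ?_) (integrable_const _) (fun n => ae_of_all _ fun x => ?_)
      (ae_of_all _ fun x => ?_)
    · have := (continuous_bumpPrim α β).comp (cN n)
      exact Continuous.aestronglyMeasurable (by fun_prop)
    · rw [Real.norm_of_nonneg (sq_nonneg _)]
      refine pow_le_pow_left₀ (sub_nonneg.2 (bumpPrim_le hαβ.le _)) ?_ 2
      exact sub_le_self _ (bumpPrim_nonneg hαβ.le _)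
    · exact ((((continuous_bumpPrim α β).tendsto _).comp (lim x)).const_sub _).pow 2
  have lim2 : Filter.Tendsto
      (fun n => ∫ x in cell, bump α β (normSq (G n) (H n) x) *
          (normSq (G n) (H n) x + 16 * ω n ^ 2)) Filter.atTop
      (nhds (∫ x in cell, bump α β (normSq g h x) * normSq g h x)) := by
    refine tendsto_integral_of_dominated_convergence
      (fun _ => (β - α) ^ 2 / 4 * (B₁ * B₁ + B₂ * B₂ + E + 16))
      (fun n => ?_) (integrable_const _) (fun n => ae_of_all _ fun x => ?_)
      (ae_of_all _ fun x => ?_)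
    · have := (continuous_bump α β).comp (cN n)
      have := cN n
      exact Continuous.aestronglyMeasurable (by fun_prop)
    · have n0 := normSq_nonneg (G n) (H n) x
      rw [Real.norm_of_nonneg (mul_nonneg (bump_nonneg _ _ _) (by positivity))]
      refine mul_le_mul (bump_le _ _ _) ?_ (by positivity) (by positivity)
      have h1 := (abs_le.1 (close n x)).2
      have h2 : normSq g h x ≤ B₁ * B₁ + B₂ * B₂ := by
        unfold normSq
        rw [← abs_mul_abs_self (g x), ← abs_mul_abs_self (h x)]
        have := hgB x
        have := hhB x
        rw [Real.norm_eq_abs] at *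
        gcongr
      have h3 : ω n * E ≤ E := mul_le_of_le_one_left hE (hω1 n)
      have h4 : ω n ^ 2 ≤ 1 := pow_le_one₀ (hω0 n).le (hω1 n)
      linarith
    · have h1 := ((continuous_bump α β).tendsto _).comp (lim x)
      have h2 := (lim x).add ((hωt.pow 2).const_mul 16)
      have h3 := h1.mul h2
      simpa using h3
  exact le_of_tendsto_of_tendsto lim1 ((lim2.pow 2).const_mul _) est

/-- The coordinates of the Euclidean plane. -/
noncomputable def coords : EuclideanSpace ℝ (Fin 2) ≃L[ℝ] ℝ × ℝ :=
  (EuclideanSpace.equiv (Fin 2) ℝ).trans (ContinuousLinearEquiv.finTwoArrow ℝ ℝ)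

lemma coords_apply (v : EuclideanSpace ℝ (Fin 2)) : coords v = (v 0, v 1) := rfl

lemma measurePreserving_coords : MeasurePreserving coords volume volume :=
  (volume_preserving_finTwoArrow ℝ).comp (PiLp.volume_preserving_ofLp (Fin 2))

lemma integral_comp_coords (F : ℝ × ℝ → ℝ) : ∫ v, F (coords v) = ∫ x, F x :=
  measurePreserving_coords.integral_comp coords.toHomeomorph.measurableEmbedding F

lemma coords_symm_fst : coords.symm (1, 0) = EuclideanSpace.single 0 1 := by
  rw [ContinuousLinearEquiv.symm_apply_eq, coords_apply]
  simp

lemma coords_symm_snd : coords.symm (0, 1) = EuclideanSpace.single 1 1 := by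
  rw [ContinuousLinearEquiv.symm_apply_eq, coords_apply]
  simp

lemma gradient_apply (f : EuclideanSpace ℝ (Fin 2) → ℝ) (v : EuclideanSpace ℝ (Fin 2))
    (i : Fin 2) : gradient f v i = fderiv ℝ f v (EuclideanSpace.single i 1) := by
  rw [← inner_gradient_left, EuclideanSpace.inner_single_right]
  simp

lemma d₁_comp_coords_symm (f : EuclideanSpace ℝ (Fin 2) → ℝ) (x : ℝ × ℝ) :
    d₁ (f ∘ coords.symm) x = gradient f (coords.symm x) 0 := by
  rw [d₁, coords.symm.comp_right_fderiv, gradient_apply, ← coords_symm_fst]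
  rfl

lemma d₂_comp_coords_symm (f : EuclideanSpace ℝ (Fin 2) → ℝ) (x : ℝ × ℝ) :
    d₂ (f ∘ coords.symm) x = gradient f (coords.symm x) 1 := by
  rw [d₂, coords.symm.comp_right_fderiv, gradient_apply, ← coords_symm_snd]
  rfl

lemma unitPeriodic_comp_coords_symm {α : Type*} {f : EuclideanSpace ℝ (Fin 2) → α}
    (hf : ∀ (x : EuclideanSpace ℝ (Fin 2)) (k : Fin 2 → ℤ),
      f (x + (WithLp.equiv 2 (Fin 2 → ℝ)).symm (fun i => (k i : ℝ))) = f x) :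
    UnitPeriodic fun x => f (coords.symm x) := by
  constructor
  · intro x
    change f (coords.symm (x + (1, 0))) = f (coords.symm x)
    rw [map_add, coords_symm_fst, ← hf (coords.symm x) ![1, 0]]
    congr 2
    ext i
    fin_cases i <;> simp
  · intro x
    change f (coords.symm (x + (0, 1))) = f (coords.symm x)
    rw [map_add, coords_symm_snd, ← hf (coords.symm x) ![0, 1]]
    congr 2
    ext i
    fin_cases i <;> simp

/-- Gradients are weakly curl free. -/
lemma integral_d₁_mul_d₂ {U φ : ℝ × ℝ → ℝ} (cU : ContDiff ℝ 1 U) (cφ : ContDiff ℝ (⊤ : ℕ∞) φ)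
    (sφ : HasCompactSupport φ) : ∫ t, d₁ U t * d₂ φ t = ∫ t, d₂ U t * d₁ φ t := by
  have c2 : ContDiff ℝ 2 φ := contDiff_infty.1 cφ 2
  have cd1 := contDiff_d₁ c2
  have cd2 := contDiff_d₂ c2
  have s1 : HasCompactSupport (d₁ φ) := sφ.fderiv_apply ℝ (1, 0)
  have s2 : HasCompactSupport (d₂ φ) := sφ.fderiv_apply ℝ (0, 1)
  have I : ∀ f k : ℝ × ℝ → ℝ, Continuous f → Continuous k → HasCompactSupport k →
      Integrable fun t => f t * k t := fun f k cf ck sk =>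
    (cf.mul ck).integrable_of_hasCompactSupport sk.mul_left
  have dU := cU.differentiable one_ne_zero
  have e1 : ∫ t, U t * d₁ (d₂ φ) t = -∫ t, d₁ U t * d₂ φ t :=
    integral_mul_fderiv_eq_neg_fderiv_mul_of_integrable
      (I _ _ (continuous_d₁ cU) cd2.continuous s2)
      (I _ _ cU.continuous (continuous_d₁ cd2) (s2.fderiv_apply ℝ (1, 0)))
      (I _ _ cU.continuous cd2.continuous s2) (fun x _ => dU x)
      fun x _ => cd2.differentiable one_ne_zero x
  have e2 : ∫ t, U t * d₂ (d₁ φ) t = -∫ t, d₂ U t * d₁ φ t :=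
    integral_mul_fderiv_eq_neg_fderiv_mul_of_integrable
      (I _ _ (continuous_d₂ cU) cd1.continuous s1)
      (I _ _ cU.continuous (continuous_d₂ cd1) (s1.fderiv_apply ℝ (0, 1)))
      (I _ _ cU.continuous cd1.continuous s1) (fun x _ => dU x)
      fun x _ => cd1.differentiable one_ne_zero x
  simp_rw [d₁_d₂_comm c2] at e1
  linarith

end PeriodicGradient

/-- **Theorem 2.1(ii)**: in dimension two, if `∇u` is `ℤ²`-periodic with nonzero average and is
a realizable electric field associated with a smooth `ℤ²`-periodic symmetric positive definite
matrix conductivity `σ`, then `∇u` does not vanish in `ℝ²`. -/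
theorem gradient_nonvanishing_of_periodic_realizable
    (u : EuclideanSpace ℝ (Fin 2) → ℝ) (hu : ContDiff ℝ 1 u)
    (hper : ∀ (x : EuclideanSpace ℝ (Fin 2)) (k : Fin 2 → ℤ),
      gradient u (x + (WithLp.equiv 2 (Fin 2 → ℝ)).symm (fun i => (k i : ℝ))) = gradient u x)
    (havg : (∫ x in {x : EuclideanSpace ℝ (Fin 2) | ∀ i, x i ∈ Set.Icc (0:ℝ) 1},
      gradient u x) ≠ 0)
    (σ : EuclideanSpace ℝ (Fin 2) → Matrix (Fin 2) (Fin 2) ℝ)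
    (hσsmooth : ∀ i j, ContDiff ℝ (⊤ : ℕ∞) fun x => σ x i j)
    (hσper : ∀ (x : EuclideanSpace ℝ (Fin 2)) (k : Fin 2 → ℤ),
      σ (x + (WithLp.equiv 2 (Fin 2 → ℝ)).symm (fun i => (k i : ℝ))) = σ x)
    (hσsym : ∀ x, (σ x).IsSymm)
    (hσpos : ∀ x, (σ x).PosDef)
    (hdiv : ∀ φ : EuclideanSpace ℝ (Fin 2) → ℝ, ContDiff ℝ (⊤ : ℕ∞) φ → HasCompactSupport φ →
      (∫ x : EuclideanSpace ℝ (Fin 2),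
        ∑ i, (∑ j, σ x i j * gradient u x j) * gradient φ x i) = 0) :
    ∀ x, gradient u x ≠ 0 := by
  have cU : ContDiff ℝ 1 (u ∘ PeriodicGradient.coords.symm) :=
    hu.comp PeriodicGradient.coords.symm.contDiff
  have pu := PeriodicGradient.unitPeriodic_comp_coords_symm hper
  have pσ := PeriodicGradient.unitPeriodic_comp_coords_symm hσper
  have cσ : ∀ i j, ContDiff ℝ 1 fun x => σ (PeriodicGradient.coords.symm x) i j := fun i j =>
    ((hσsmooth i j).comp PeriodicGradient.coords.symm.contDiff).of_le
      (by exact_mod_cast le_top)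
  have cg : ∀ i, Continuous fun x => gradient u (PeriodicGradient.coords.symm x) i := by
    intro i
    simp_rw [PeriodicGradient.gradient_apply]
    exact ((hu.continuous_fderiv one_ne_zero).comp
      PeriodicGradient.coords.symm.continuous).clm_apply continuous_const
  have hnormSq : ∀ x, PeriodicGradient.normSq
      (fun x => gradient u (PeriodicGradient.coords.symm x) 0)
      (fun x => gradient u (PeriodicGradient.coords.symm x) 1) x =
        ‖gradient u (PeriodicGradient.coords.symm x)‖ ^ 2 := by
    intro x
    rw [EuclideanSpace.norm_sq_eq, Fin.sum_univ_two, PeriodicGradient.normSq,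
      Real.norm_eq_abs, Real.norm_eq_abs, sq_abs, sq_abs, sq, sq]
  obtain ⟨x₀, hx₀⟩ : ∃ x, gradient u x ≠ 0 := by
    by_contra! h
    simp [h] at havg
  intro x
  have key := PeriodicGradient.normSq_pos_of_weak_solution (cg 0) (cg 1)
    (pu.comp fun v => v 0) (pu.comp fun v => v 1) (cσ 0 0) (cσ 0 1) (cσ 1 1)
    (pσ.comp fun A => A 0 0) (pσ.comp fun A => A 0 1) (pσ.comp fun A => A 1 1)
    (fun x => (hσpos _).diag_pos) (fun x => (hσpos _).diag_pos)
    (fun x => by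
      have h := (hσpos (PeriodicGradient.coords.symm x)).det_pos
      rwa [Matrix.det_fin_two, (hσsym _).apply 0 1] at h)
    (fun φ cφ sφ => by
      have h := PeriodicGradient.integral_d₁_mul_d₂ cU cφ sφ
      simpa only [PeriodicGradient.d₁_comp_coords_symm,
        PeriodicGradient.d₂_comp_coords_symm] using h)
    (fun φ cφ sφ => by
      have h := hdiv (φ ∘ PeriodicGradient.coords)
        (cφ.comp PeriodicGradient.coords.contDiff)
        (sφ.comp_homeomorph PeriodicGradient.coords.toHomeomorph)
      rw [← h, ← PeriodicGradient.integral_comp_coords]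
      congr 1
      ext v
      have h1 := PeriodicGradient.d₁_comp_coords_symm (φ ∘ PeriodicGradient.coords)
        (PeriodicGradient.coords v)
      have h2 := PeriodicGradient.d₂_comp_coords_symm (φ ∘ PeriodicGradient.coords)
        (PeriodicGradient.coords v)
      have e : (φ ∘ PeriodicGradient.coords) ∘ PeriodicGradient.coords.symm = φ := by
        ext y
        simp
      rw [e, ContinuousLinearEquiv.symm_apply_apply] at h1 h2
      simp only [Fin.sum_univ_two, ContinuousLinearEquiv.symm_apply_apply, h1, h2,
        (hσsym v).apply 0 1])
    (x₀ := PeriodicGradient.coords x₀) (by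
      rw [hnormSq, ContinuousLinearEquiv.symm_apply_apply]
      have := norm_pos_iff.2 hx₀
      positivity)
    (PeriodicGradient.coords x)
  rw [hnormSq, ContinuousLinearEquiv.symm_apply_apply] at key
  intro h
  simp [h] at key
end

section
/- Let χ : ℝ → ℝ be the 1-periodic function equal to 1 on [0,1/2) and 0 on [1/2,1), and define u(x₁,x₂) := x₂ − x₁ + ∫₀^{x₁} χ(t) dt, so that ∇u = χ(x₁) e₂ + (1−χ(x₁))(e₂ − e₁) almost everywhere in ℝ². Fix r ∈ (0,1/2) and set Q := (−r,r)². Then there is NO essentially bounded measurable function σ : Q → ℝ with σ(x) > 0 for almost every x ∈ Q such that ∫_Q σ(x) (∇u(x) · ∇φ(x)) dx = 0 for every φ ∈ C_c^∞(Q). (Example 2.1: a nonvanishing Lipschitz gradient that is not locally isotropically realizable.) -/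
open MeasureTheory

/-- A smooth cutoff in one variable: it vanishes left of `-r/2`, equals a fixed profile up to `0`,
and drops to zero on `[0, r / (2 (n + 1))]`. -/
noncomputable def steepCutoff (r : ℝ) (n : ℕ) (t : ℝ) : ℝ :=
  Real.smoothTransition (2 + 4 / r * t) * Real.smoothTransition (1 - 2 * (n + 1) / r * t)

theorem contDiff_steepCutoff (r : ℝ) (n : ℕ) : ContDiff ℝ (⊤ : ℕ∞) (steepCutoff r n) :=
  (Real.smoothTransition.contDiff.comp (by fun_prop)).mul
    (Real.smoothTransition.contDiff.comp (by fun_prop))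

theorem steepCutoff_of_nonpos {r : ℝ} (hr : 0 < r) (n : ℕ) {t : ℝ} (ht : t ≤ 0) :
    steepCutoff r n t = Real.smoothTransition (2 + 4 / r * t) := by
  have h : 2 * ((n : ℝ) + 1) / r * t ≤ 0 := mul_nonpos_of_nonneg_of_nonpos (by positivity) ht
  rw [steepCutoff, Real.smoothTransition.one_of_one_le (x := 1 - _) (by linarith), mul_one]

theorem deriv_steepCutoff_of_neg {r : ℝ} (hr : 0 < r) (n : ℕ) {t : ℝ} (ht : t < 0) :
    deriv (steepCutoff r n) t = deriv (fun s ↦ Real.smoothTransition (2 + 4 / r * s)) t := by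
  refine Filter.EventuallyEq.deriv_eq ?_
  filter_upwards [Iio_mem_nhds ht] with s hs using steepCutoff_of_nonpos hr n (le_of_lt hs)

theorem steepCutoff_eq_zero_of_le {r : ℝ} (n : ℕ) {t : ℝ}
    (ht : 1 ≤ 2 * (n + 1) / r * t) : steepCutoff r n t = 0 := by
  rw [steepCutoff, Real.smoothTransition.zero_of_nonpos (x := 1 - _) (by linarith), mul_zero]

theorem abs_steepCutoff_le_one (r : ℝ) (n : ℕ) (t : ℝ) : |steepCutoff r n t| ≤ 1 := by
  have h1 := Real.smoothTransition.nonneg (2 + 4 / r * t)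
  have h2 := Real.smoothTransition.nonneg (1 - 2 * (n + 1) / r * t)
  rw [steepCutoff, abs_of_nonneg (mul_nonneg h1 h2)]
  exact mul_le_one₀ (Real.smoothTransition.le_one _) h2 (Real.smoothTransition.le_one _)

theorem support_steepCutoff_subset {r : ℝ} (hr : 0 < r) (n : ℕ) :
    Function.support (steepCutoff r n) ⊆ Set.Icc (-(r / 2)) (r / 2) := by
  intro t ht
  by_contra hmem
  apply ht
  rw [Set.mem_Icc, not_and_or, not_le, not_le] at hmem
  rcases hmem with h | h
  · have h4 : 4 / r * t ≤ 4 / r * (-(r / 2)) := by gcongr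
    have h5 : 4 / r * (-(r / 2)) = -2 := by field_simp; norm_num
    rw [steepCutoff, Real.smoothTransition.zero_of_nonpos (by linarith), zero_mul]
  · apply steepCutoff_eq_zero_of_le
    have h4 : 2 * ((n : ℝ) + 1) / r * (r / 2) ≤ 2 * (n + 1) / r * t := by gcongr
    have h5 : 2 * ((n : ℝ) + 1) / r * (r / 2) = n + 1 := by field_simp
    have h6 : (0 : ℝ) ≤ n := n.cast_nonneg
    linarith

theorem eventually_steepCutoff_eq_zero {r : ℝ} (hr : 0 < r) {t : ℝ} (ht : 0 < t) :
    ∀ᶠ n : ℕ in Filter.atTop, steepCutoff r n t = 0 := by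
  filter_upwards [Filter.eventually_ge_atTop ⌈r / (2 * t)⌉₊] with n hn
  apply steepCutoff_eq_zero_of_le
  have h1 : r / (2 * t) ≤ n := Nat.ceil_le.mp hn
  rw [div_le_iff₀ (by positivity)] at h1
  rw [div_mul_eq_mul_div, le_div_iff₀ hr]
  nlinarith

/-- The derivative of `(a, b) ↦ f (a + b) * h a` in the direction `(v, w)`. -/
theorem fderiv_comp_add_mul_apply {f h : ℝ → ℝ} (hf : Differentiable ℝ f)
    (hh : Differentiable ℝ h) (x : ℝ × ℝ) (v w : ℝ) :
    fderiv ℝ (fun y : ℝ × ℝ ↦ f (y.1 + y.2) * h y.1) x (v, w) =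
      deriv f (x.1 + x.2) * (v + w) * h x.1 + f (x.1 + x.2) * (deriv h x.1 * v) := by
  have e1 : HasFDerivAt (fun y : ℝ × ℝ ↦ f (y.1 + y.2)) _ x :=
    (hf (x.1 + x.2)).hasDerivAt.comp_hasFDerivAt x
      ((hasFDerivAt_fst (𝕜 := ℝ) (p := x)).add (hasFDerivAt_snd (𝕜 := ℝ) (p := x)))
  have e2 : HasFDerivAt (fun y : ℝ × ℝ ↦ h y.1) _ x :=
    (hh x.1).hasDerivAt.comp_hasFDerivAt x (hasFDerivAt_fst (𝕜 := ℝ) (p := x))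
  rw [(e1.fun_mul e2).fderiv]
  simp
  ring

theorem tsupport_comp_add_mul_subset {f h : ℝ → ℝ} {a b : ℝ}
    (hf : Function.support f ⊆ Set.Icc (-a) a) (hh : Function.support h ⊆ Set.Icc (-b) b) :
    tsupport (fun y : ℝ × ℝ ↦ f (y.1 + y.2) * h y.1) ⊆
      Set.Icc (-b) b ×ˢ Set.Icc (-(a + b)) (a + b) := by
  refine closure_minimal ?_ (isClosed_Icc.prod isClosed_Icc)
  intro y hy
  have h1 := hf (left_ne_zero_of_mul hy)
  have h2 := hh (right_ne_zero_of_mul hy)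
  simp only [Set.mem_Icc, Set.mem_prod] at h1 h2 ⊢
  exact ⟨h2, by linarith, by linarith⟩

theorem ae_fst_ne (c : ℝ) : ∀ᵐ x : ℝ × ℝ, x.1 ≠ c :=
  Measure.quasiMeasurePreserving_fst.ae (Measure.ae_ne volume c)

/-- **Example 2.1**: with `χ` the `1`-periodic characteristic function of `[0,1/2)` and
`u(x) = x₂ - x₁ + ∫₀^{x₁} χ`, whose gradient is `∇u = (χ(x₁) - 1, 1)` a.e., there is no
essentially bounded measurable `σ > 0` on the square `Q = (-r,r)²` making `σ ∇u`
divergence free in the sense of distributions on `Q`. -/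
theorem not_locally_isotropically_realizable_lipschitz (r : ℝ) (hr : r ∈ Set.Ioo 0 (1/2 : ℝ)) :
    ¬ ∃ σ : ℝ × ℝ → ℝ, Measurable σ ∧
      (∃ M : ℝ, ∀ᵐ x ∂(volume.restrict (Set.Ioo (-r) r ×ˢ Set.Ioo (-r) r)), |σ x| ≤ M) ∧
      (∀ᵐ x ∂(volume.restrict (Set.Ioo (-r) r ×ˢ Set.Ioo (-r) r)), 0 < σ x) ∧
      ∀ φ : ℝ × ℝ → ℝ, ContDiff ℝ (⊤ : ℕ∞) φ → HasCompactSupport φ →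
        tsupport φ ⊆ Set.Ioo (-r) r ×ˢ Set.Ioo (-r) r →
        (∫ x in Set.Ioo (-r) r ×ˢ Set.Ioo (-r) r,
          σ x * (((if Int.fract x.1 < 1/2 then (1:ℝ) else 0) - 1) * fderiv ℝ φ x (1, 0)
            + fderiv ℝ φ x (0, 1))) = 0 := by
  rintro ⟨σ, hσm, ⟨M, hM⟩, hσ, hdiv⟩
  obtain ⟨hr0, hr1⟩ := hr
  set Q : Set (ℝ × ℝ) := Set.Ioo (-r) r ×ˢ Set.Ioo (-r) r with hQ
  have hQo : IsOpen Q := isOpen_Ioo.prod isOpen_Ioo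
  have hQne : ∀ᵐ x ∂(volume.restrict Q), x.1 ≠ 0 := ae_restrict_of_ae (ae_fst_ne 0)
  have hQmem : ∀ᵐ x ∂(volume.restrict Q), x ∈ Q := ae_restrict_mem hQo.measurableSet
  let f : ContDiffBump (0 : ℝ) := ⟨r / 8, r / 4, by positivity, by linarith⟩
  have hfsm : ContDiff ℝ (⊤ : ℕ∞) f := f.contDiff
  have hfsupp : Function.support f ⊆ Set.Icc (-(r / 4)) (r / 4) := by
    rw [f.support_eq, Real.ball_eq_Ioo, zero_sub, zero_add]
    exact Set.Ioo_subset_Icc_self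
  have hdf : Continuous (deriv f) := hfsm.continuous_deriv (by simp)
  set p : ℝ → ℝ := fun s ↦ Real.smoothTransition (2 + 4 / r * s) with hp
  have hpsm : ContDiff ℝ (⊤ : ℕ∞) p := Real.smoothTransition.contDiff.comp (by fun_prop)
  have hdp : Continuous (deriv p) := hpsm.continuous_deriv (by simp)
  have hpmono : Monotone p := fun s t hst ↦ Real.smoothTransition.monotone (by gcongr)
  have hdp0 (t : ℝ) : 0 ≤ deriv p t := hpmono.deriv_nonneg
  let χ : ℝ → ℝ := fun t ↦ if Int.fract t < 1 / 2 then 1 else 0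
  have hχm : Measurable χ :=
    Measurable.ite (measurableSet_lt measurable_fract measurable_const) measurable_const
      measurable_const
  have hχneg {t : ℝ} (h1 : -r < t) (h2 : t < 0) : χ t = 0 := by
    have : Int.fract t = t + 1 := Int.fract_eq_iff.mpr
      ⟨by linarith, by linarith, -1, by push_cast; ring⟩
    simp only [χ, this]
    exact if_neg (by linarith)
  have hχpos {t : ℝ} (h1 : 0 < t) (h2 : t < r) : χ t = 1 := by
    have : Int.fract t = t := Int.fract_eq_self.mpr ⟨h1.le, by linarith⟩
    simp only [χ, this]
    exact if_pos (by linarith)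
  let F : ℕ → ℝ × ℝ → ℝ := fun n x ↦
    σ x * ((χ x.1 - 1) * (deriv f (x.1 + x.2) * steepCutoff r n x.1
      + f (x.1 + x.2) * deriv (steepCutoff r n) x.1)
      + deriv f (x.1 + x.2) * steepCutoff r n x.1)
  have hFint (n : ℕ) : ∫ x in Q, F n x = 0 := by
    have hh := contDiff_steepCutoff r n
    have hts := tsupport_comp_add_mul_subset hfsupp (support_steepCutoff_subset hr0 n)
    rw [← hdiv (fun y ↦ f (y.1 + y.2) * steepCutoff r n y.1) (by fun_prop)
      ((isCompact_Icc.prod isCompact_Icc).of_isClosed_subset (isClosed_tsupport _) hts)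
      (hts.trans (Set.prod_mono (Set.Icc_subset_Ioo (by linarith) (by linarith))
        (Set.Icc_subset_Ioo (by linarith) (by linarith))))]
    congr 1
    funext x
    have hfd : Differentiable ℝ f := hfsm.differentiable (by simp)
    have hhd : Differentiable ℝ (steepCutoff r n) := hh.differentiable (by simp)
    rw [fderiv_comp_add_mul_apply hfd hhd, fderiv_comp_add_mul_apply hfd hhd]
    simp only [F, χ]
    ring
  let G : ℝ × ℝ → ℝ := fun x ↦
    if x.1 < 0 then σ x * (f (x.1 + x.2) * deriv p x.1) else 0
  have hFneg (n : ℕ) {x : ℝ × ℝ} (hx : x ∈ Q) (h0 : x.1 < 0) : F n x = -G x := by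
    simp only [F, G, hχneg hx.1.1 h0, deriv_steepCutoff_of_neg hr0 n h0, if_pos h0, hp]
    ring
  have hFpos (n : ℕ) {x : ℝ × ℝ} (hx : x ∈ Q) (h0 : 0 < x.1) :
      F n x = σ x * (deriv f (x.1 + x.2) * steepCutoff r n x.1) := by
    simp only [F, hχpos h0 hx.1.2]
    ring
  let B : ℝ × ℝ → ℝ := fun x ↦ M * (|f (x.1 + x.2) * deriv p x.1| + |deriv f (x.1 + x.2)|)
  have hBint : Integrable B (volume.restrict Q) := by
    have hBc : Continuous B := by
      have := f.continuous
      fun_prop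
    exact (hBc.continuousOn.integrableOn_compact (isCompact_Icc.prod isCompact_Icc)).mono_set
      (Set.prod_mono Set.Ioo_subset_Icc_self Set.Ioo_subset_Icc_self)
  have hGB : ∀ᵐ x ∂(volume.restrict Q), ‖G x‖ ≤ B x := by
    filter_upwards [hM] with x hx
    have hM0 : 0 ≤ M := (abs_nonneg _).trans hx
    by_cases h0 : x.1 < 0
    · simp only [G, B, if_pos h0, Real.norm_eq_abs]
      rw [abs_mul]
      gcongr
      exact le_add_of_nonneg_right (abs_nonneg _)
    · simp only [G, B, if_neg h0, norm_zero]
      positivity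
  have hfm : Measurable f := f.continuous.measurable
  have hGm : Measurable G :=
    Measurable.ite (measurableSet_lt measurable_fst measurable_const)
      (by fun_prop) measurable_const
  have hGint : Integrable G (volume.restrict Q) := hBint.mono' hGm.aestronglyMeasurable hGB
  have hlim : Filter.Tendsto (fun n ↦ ∫ x in Q, F n x) Filter.atTop
      (nhds (∫ x in Q, -G x)) := by
    refine tendsto_integral_of_dominated_convergence B (fun n ↦ ?_) hBint (fun n ↦ ?_) ?_
    · have hh : Measurable (steepCutoff r n) := (contDiff_steepCutoff r n).continuous.measurable
      have hdh : Measurable (deriv (steepCutoff r n)) := measurable_deriv _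
      have : Measurable (F n) := by fun_prop
      exact this.aestronglyMeasurable
    · filter_upwards [hM, hQne, hQmem, hGB] with x hx hne hxQ hxG
      rcases lt_or_gt_of_ne hne with h0 | h0
      · rwa [hFneg n hxQ h0, norm_neg]
      · have hM0 : 0 ≤ M := (abs_nonneg _).trans hx
        rw [hFpos n hxQ h0, Real.norm_eq_abs, abs_mul, abs_mul]
        simp only [B]
        gcongr
        calc |deriv f (x.1 + x.2)| * |steepCutoff r n x.1| ≤ |deriv f (x.1 + x.2)| :=
              mul_le_of_le_one_right (abs_nonneg _) (abs_steepCutoff_le_one r n _)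
          _ ≤ _ := le_add_of_nonneg_left (abs_nonneg _)
    · filter_upwards [hQne, hQmem] with x hne hxQ
      rcases lt_or_gt_of_ne hne with h0 | h0
      · simp only [hFneg _ hxQ h0]
        exact tendsto_const_nhds
      · refine tendsto_const_nhds.congr' ?_
        filter_upwards [eventually_steepCutoff_eq_zero hr0 h0] with n hn
        rw [hFpos n hxQ h0, hn]
        simp [G, h0.le]
  have hG0 : ∫ x in Q, G x = 0 := by
    simp only [hFint, integral_neg] at hlim
    simpa using (tendsto_nhds_unique hlim tendsto_const_nhds)
  have hGnn : 0 ≤ᵐ[volume.restrict Q] G := by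
    filter_upwards [hσ] with x hx
    simp only [G, Pi.zero_apply]
    split_ifs
    · exact mul_nonneg hx.le (mul_nonneg f.nonneg (hdp0 _))
    · exact le_rfl
  have hGae := (integral_eq_zero_iff_of_nonneg_ae hGnn hGint).mp hG0
  have hUo : IsOpen (Q ∩ {x | x.1 < 0}) := hQo.inter (isOpen_lt continuous_fst continuous_const)
  have hzero : (fun x : ℝ × ℝ ↦ f (x.1 + x.2) * deriv p x.1)
      =ᵐ[volume.restrict (Q ∩ {x | x.1 < 0})] fun _ ↦ 0 := by
    filter_upwards [ae_restrict_of_ae_restrict_of_subset Set.inter_subset_left hGae,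
      ae_restrict_of_ae_restrict_of_subset Set.inter_subset_left hσ,
      ae_restrict_mem hUo.measurableSet] with x hx hxσ hxU
    simp only [G, if_pos (show x.1 < 0 from hxU.2), Pi.zero_apply] at hx
    exact (mul_eq_zero.mp hx).resolve_left hxσ.ne'
  have hEq := Measure.eqOn_open_of_ae_eq hzero hUo
    (by have := f.continuous; fun_prop) continuousOn_const
  obtain ⟨c, hc, hcp⟩ := exists_deriv_eq_slope p (show -(r / 2) < -(r / 4) by linarith)
    hpsm.continuous.continuousOn (hpsm.differentiable (by simp)).differentiableOn
  have hp1 : p (-(r / 4)) = 1 := Real.smoothTransition.one_of_one_le (by field_simp; norm_num)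
  have hp0 : p (-(r / 2)) = 0 := Real.smoothTransition.zero_of_nonpos (by field_simp; norm_num)
  have hcpos : 0 < deriv p c := by
    rw [hcp, hp1, hp0]
    exact div_pos (by norm_num) (by linarith)
  have hcz := hEq (x := (c, -c)) ⟨⟨⟨by linarith [hc.1], by linarith [hc.2]⟩,
    by linarith [hc.2], by linarith [hc.1]⟩, show c < 0 by linarith [hc.2]⟩
  have hf0 : 0 < f 0 := f.pos_of_mem_ball (Metric.mem_ball_self f.rOut_pos)
  simp only [add_neg_cancel] at hcz
  exact (mul_pos hf0 hcpos).ne' hcz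
end

section
/- Let u, v : ℝ² → ℝ be continuously differentiable with ∇u and ∇v ℤ²-periodic, and suppose det(∇u(x), ∇v(x)) = R⊥∇u(x) · ∇v(x) > 0 for every x ∈ ℝ². Then there exists a continuous, ℤ²-periodic, symmetric matrix-valued function σ : ℝ² → ℝ^{2×2} such that σ(x) is positive definite with det σ(x) = |∇u(x)|^{−4} for every x, and σ(x)∇u(x) = −R⊥∇v(x) for every x ∈ ℝ²; consequently ∫_{ℝ²} (σ∇u) · ∇φ dx = 0 for every φ ∈ C_c^∞(ℝ²), i.e. ∇u is a realizable electric field. (Theorem 2.2, sufficiency.) -/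
open MeasureTheory

/-- The conductivity `J Jᵀ / D + p⊥ p⊥ᵀ / (D |p|⁴)` for `p = (a, b)`, `q = (c, d)`, where
`J = (d, -c) = -R⊥q`, `p⊥ = (-b, a)` and `D = det (p, q) = a d - b c`. -/
noncomputable def conductivity (a b c d : ℝ) : Matrix (Fin 2) (Fin 2) ℝ :=
  (a * d - b * c)⁻¹ •
    (!![d * d, -(c * d); -(c * d), c * c] +
      ((a ^ 2 + b ^ 2) ^ 2)⁻¹ • !![b * b, -(a * b); -(a * b), a * a])

lemma sq_add_sq_pos_of_det_pos {a b c d : ℝ} (h : 0 < a * d - b * c) : 0 < a ^ 2 + b ^ 2 := by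
  by_contra! hn
  have ha : a = 0 := by nlinarith [sq_nonneg a, sq_nonneg b]
  have hb : b = 0 := by nlinarith [sq_nonneg a, sq_nonneg b]
  simp [ha, hb] at h

lemma conductivity_isSymm (a b c d : ℝ) : (conductivity a b c d).IsSymm := by
  ext i j
  fin_cases i <;> fin_cases j <;> simp [conductivity]

lemma conductivity_det {a b c d : ℝ} (h : 0 < a * d - b * c) :
    (conductivity a b c d).det = ((a ^ 2 + b ^ 2) ^ 2)⁻¹ := by
  have hD := h.ne'
  have hN := (sq_add_sq_pos_of_det_pos h).ne'
  simp only [conductivity, Matrix.det_fin_two, Matrix.smul_apply, Matrix.add_apply,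
    Matrix.of_apply, Matrix.cons_val', Matrix.cons_val_zero, Matrix.cons_val_one,
    Matrix.cons_val_fin_one, smul_eq_mul]
  field_simp
  ring

lemma conductivity_mulVec {a b c d : ℝ} (h : 0 < a * d - b * c) :
    (conductivity a b c d).mulVec ![a, b] = ![d, -c] := by
  have hD := h.ne'
  have hN := (sq_add_sq_pos_of_det_pos h).ne'
  ext i
  fin_cases i <;>
    simp [conductivity, Matrix.mulVec, dotProduct, Fin.sum_univ_two] <;>
    field_simp <;> ring

lemma conductivity_posDef {a b c d : ℝ} (h : 0 < a * d - b * c) :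
    (conductivity a b c d).PosDef := by
  have hN := sq_add_sq_pos_of_det_pos h
  refine .of_dotProduct_mulVec_pos ?_ fun x hx => ?_
  · rw [Matrix.IsHermitian, Matrix.conjTranspose_eq_transpose_of_trivial]
    exact conductivity_isSymm a b c d
  have key : star x ⬝ᵥ (conductivity a b c d).mulVec x = (a * d - b * c)⁻¹ *
      ((d * x 0 - c * x 1) ^ 2 + ((a ^ 2 + b ^ 2) ^ 2)⁻¹ * (b * x 0 - a * x 1) ^ 2) := by
    simp [conductivity, Matrix.mulVec, dotProduct, Fin.sum_univ_two]
    ring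
  rw [key]
  refine mul_pos (inv_pos.2 h) ?_
  have hN' : 0 < ((a ^ 2 + b ^ 2) ^ 2)⁻¹ := by positivity
  by_cases h1 : d * x 0 - c * x 1 = 0
  · have h2 : b * x 0 - a * x 1 ≠ 0 := by
      intro h2
      apply hx
      have e0 : (a * d - b * c) * x 0 = 0 := by linear_combination a * h1 - c * h2
      have e1 : (a * d - b * c) * x 1 = 0 := by linear_combination b * h1 - d * h2
      ext i
      fin_cases i
      · simpa [h.ne'] using e0
      · simpa [h.ne'] using e1
    positivity
  · positivity

lemma continuous_conductivity_apply {X : Type*} [TopologicalSpace X] {a b c d : X → ℝ}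
    (ha : Continuous a) (hb : Continuous b) (hc : Continuous c) (hd : Continuous d)
    (h : ∀ x, 0 < a x * d x - b x * c x) (i j : Fin 2) :
    Continuous fun x => conductivity (a x) (b x) (c x) (d x) i j := by
  have hD : Continuous fun x => (a x * d x - b x * c x)⁻¹ :=
    ((ha.mul hd).sub (hb.mul hc)).inv₀ fun x => (h x).ne'
  have hN : Continuous fun x => ((a x ^ 2 + b x ^ 2) ^ 2)⁻¹ :=
    (((ha.pow 2).add (hb.pow 2)).pow 2).inv₀ fun x =>
      (pow_pos (sq_add_sq_pos_of_det_pos (h x)) 2).ne'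
  simp only [conductivity, Matrix.smul_apply, Matrix.add_apply, smul_eq_mul]
  refine hD.mul (.add ?_ (hN.mul ?_)) <;> fin_cases i <;> fin_cases j <;> simp <;> fun_prop

lemma gradient_apply {n : ℕ} (f : EuclideanSpace ℝ (Fin n) → ℝ) (x : EuclideanSpace ℝ (Fin n))
    (i : Fin n) : gradient f x i = fderiv ℝ f x (EuclideanSpace.single i 1) := by
  rw [← inner_gradient_left, EuclideanSpace.inner_single_right]
  simp

lemma continuous_gradient_apply {n : ℕ} {f : EuclideanSpace ℝ (Fin n) → ℝ}
    (hf : ContDiff ℝ 1 f) (i : Fin n) : Continuous fun x => gradient f x i := by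
  simp only [gradient_apply]
  exact (hf.continuous_fderiv one_ne_zero).clm_apply continuous_const

section IntegrationByParts

variable {E : Type*} [NormedAddCommGroup E] [NormedSpace ℝ E]
  [MeasurableSpace E] [BorelSpace E] {μ : Measure E} {f φ : E → ℝ}

lemma integrable_fderiv_mul_fderiv [IsFiniteMeasureOnCompacts μ] (hf : ContDiff ℝ 1 f) (hφ : ContDiff ℝ 1 φ)
    (hc : HasCompactSupport φ) (a b : E) :
    Integrable (fun x => fderiv ℝ f x a * fderiv ℝ φ x b) μ :=
  (((hf.continuous_fderiv one_ne_zero).clm_apply continuous_const).mul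
    ((hφ.continuous_fderiv one_ne_zero).clm_apply continuous_const)).integrable_of_hasCompactSupport
    (hc.fderiv_apply ℝ b).mul_left

variable [FiniteDimensional ℝ E] [μ.IsAddHaarMeasure]

lemma integral_fderiv_mul_fderiv (hf : ContDiff ℝ 1 f) (hφ : ContDiff ℝ 2 φ)
    (hc : HasCompactSupport φ) (a b : E) :
    ∫ x, fderiv ℝ f x a * fderiv ℝ φ x b ∂μ =
      -∫ x, f x * fderiv ℝ (fderiv ℝ φ) x a b ∂μ := by
  have hφ' : ContDiff ℝ 1 (fderiv ℝ φ) := hφ.fderiv_right (by norm_num)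
  have hg : ContDiff ℝ 1 fun x => fderiv ℝ φ x b := hφ'.clm_apply contDiff_const
  have hgc : HasCompactSupport fun x => fderiv ℝ φ x b := hc.fderiv_apply ℝ b
  have hgd (x : E) : fderiv ℝ (fun y => fderiv ℝ φ y b) x a = fderiv ℝ (fderiv ℝ φ) x a b := by
    rw [fderiv_clm_apply (hφ'.differentiable one_ne_zero x) (differentiableAt_const b)]
    simp
  simp only [← hgd]
  rw [integral_mul_fderiv_eq_neg_fderiv_mul_of_integrable (f := f)
    (g := fun x => fderiv ℝ φ x b), neg_neg]
  · exact integrable_fderiv_mul_fderiv hf (hφ.of_le (by norm_num)) hc a b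
  · exact (hf.continuous.mul ((hg.continuous_fderiv one_ne_zero).clm_apply
      continuous_const)).integrable_of_hasCompactSupport (hgc.fderiv_apply ℝ a).mul_left
  · exact (hf.continuous.mul hg.continuous).integrable_of_hasCompactSupport hgc.mul_left
  · exact fun x _ => hf.differentiable one_ne_zero x
  · exact fun x _ => hg.differentiable one_ne_zero x

lemma integral_fderiv_mul_fderiv_sub_eq_zero (hf : ContDiff ℝ 1 f) (hφ : ContDiff ℝ 2 φ)
    (hc : HasCompactSupport φ) (a b : E) :
    ∫ x, (fderiv ℝ f x a * fderiv ℝ φ x b - fderiv ℝ f x b * fderiv ℝ φ x a) ∂μ = 0 := by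
  have hφ1 : ContDiff ℝ 1 φ := hφ.of_le (by norm_num)
  rw [integral_sub (integrable_fderiv_mul_fderiv hf hφ1 hc a b)
    (integrable_fderiv_mul_fderiv hf hφ1 hc b a), integral_fderiv_mul_fderiv hf hφ hc,
    integral_fderiv_mul_fderiv hf hφ hc, sub_eq_zero]
  congr! 4 with x
  exact (hφ.contDiffAt.isSymmSndFDerivAt (by simp)).eq a b

end IntegrationByParts

/-- **Theorem 2.2** (sufficiency): if `u, v` are `C¹` on `ℝ²` with `ℤ²`-periodic gradients and
`det(∇u, ∇v) = R⊥∇u · ∇v > 0` everywhere, then there is a continuous `ℤ²`-periodic symmetric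
positive definite matrix conductivity `σ` with `det σ = |∇u|⁻⁴` and `σ∇u = -R⊥∇v`, so that
`σ∇u` is divergence free in the sense of distributions: `∇u` is a realizable electric field. -/
theorem realizable_of_positive_jacobian
    (u v : EuclideanSpace ℝ (Fin 2) → ℝ) (hu : ContDiff ℝ 1 u) (hv : ContDiff ℝ 1 v)
    (huper : ∀ (x : EuclideanSpace ℝ (Fin 2)) (k : Fin 2 → ℤ),
      gradient u (x + (WithLp.equiv 2 (Fin 2 → ℝ)).symm (fun i => (k i : ℝ))) = gradient u x)
    (hvper : ∀ (x : EuclideanSpace ℝ (Fin 2)) (k : Fin 2 → ℤ),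
      gradient v (x + (WithLp.equiv 2 (Fin 2 → ℝ)).symm (fun i => (k i : ℝ))) = gradient v x)
    (hdet : ∀ x, 0 < gradient u x 0 * gradient v x 1 - gradient u x 1 * gradient v x 0) :
    ∃ σ : EuclideanSpace ℝ (Fin 2) → Matrix (Fin 2) (Fin 2) ℝ,
      (∀ i j, Continuous fun x => σ x i j) ∧
      (∀ (x : EuclideanSpace ℝ (Fin 2)) (k : Fin 2 → ℤ),
        σ (x + (WithLp.equiv 2 (Fin 2 → ℝ)).symm (fun i => (k i : ℝ))) = σ x) ∧
      (∀ x, (σ x).IsSymm) ∧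
      (∀ x, (σ x).PosDef) ∧
      (∀ x, (σ x).det = (‖gradient u x‖ ^ 4)⁻¹) ∧
      (∀ x, (fun i => ∑ j, σ x i j * gradient u x j)
        = ![gradient v x 1, -(gradient v x 0)]) ∧
      ∀ φ : EuclideanSpace ℝ (Fin 2) → ℝ, ContDiff ℝ (⊤ : ℕ∞) φ → HasCompactSupport φ →
        (∫ x : EuclideanSpace ℝ (Fin 2),
          ∑ i, (∑ j, σ x i j * gradient u x j) * gradient φ x i) = 0 := by
  have hcu := continuous_gradient_apply hu
  have hcv := continuous_gradient_apply hv
  have hflux (x : EuclideanSpace ℝ (Fin 2)) :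
      (fun i => ∑ j, conductivity (gradient u x 0) (gradient u x 1) (gradient v x 0)
        (gradient v x 1) i j * gradient u x j) = ![gradient v x 1, -(gradient v x 0)] := by
    rw [← conductivity_mulVec (hdet x)]
    ext i
    simp [Matrix.mulVec, dotProduct, Fin.sum_univ_two]
  refine ⟨fun x => conductivity (gradient u x 0) (gradient u x 1) (gradient v x 0)
    (gradient v x 1), fun i j => ?_, fun x k => ?_, fun x => conductivity_isSymm _ _ _ _,
    fun x => conductivity_posDef (hdet x), fun x => ?_, hflux, fun φ hφ hc => ?_⟩
  · exact continuous_conductivity_apply (hcu 0) (hcu 1) (hcv 0) (hcv 1) hdet i j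
  · simp only [huper, hvper]
  · rw [conductivity_det (hdet x), show ‖gradient u x‖ ^ 4 = (‖gradient u x‖ ^ 2) ^ 2 by ring,
      EuclideanSpace.real_norm_sq_eq, Fin.sum_univ_two]
  · refine (integral_congr_ae (.of_forall fun x => ?_)).trans
      (integral_fderiv_mul_fderiv_sub_eq_zero (μ := volume) hv
        (contDiff_infty.1 hφ 2) hc
        (EuclideanSpace.single (1 : Fin 2) (1 : ℝ)) (EuclideanSpace.single (0 : Fin 2) (1 : ℝ)))
    have e0 := congrFun (hflux x) 0
    have e1 := congrFun (hflux x) 1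
    simp only [Matrix.cons_val_zero, Matrix.cons_val_one] at e0 e1
    simp only [← gradient_apply, Fin.sum_univ_two (M := ℝ)] at e0 e1 ⊢
    rw [e0, e1]
    ring
end
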